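/- arXiv:2201.00799 — 9 statements merged into one kernel-verified Lean document; each statement's English description precedes it below -/
import Mathlib

section
/- Geometry-of-numbers counting lemma: Let 𝐌 = (b_{i,j})_{1 ≤ i,j ≤ m} be a non-singular m-by-m matrix with integer entries satisfying |b_{i,j}| ≤ C for all 1 ≤ i,j ≤ m. Let c⃗ ∈ ℤ^m, let D ≥ 1, let d_1, …, d_m be integers with d_i ≥ D, and let N_1, …, N_m be real numbers, each ≥ D. Then the number of vectors n⃗ ∈ ℤ^m with N_i ≤ n_i ≤ 2N_i for all i and d_i ∣ (𝐌 n⃗ + c⃗)_i for all 1 ≤ i ≤ m is at most (2Cm/D)^m · ∏_{i=1}^m N_i. -/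
/-- Geometry-of-numbers counting lemma: if `M` is a nonsingular `m × m` integer matrix with
entries bounded by `C`, `c ∈ ℤ^m`, `d_i ≥ D ≥ 1` are integer moduli and `N_i ≥ D` are reals,
then the number of `n ∈ ℤ^m` with `N_i ≤ n_i ≤ 2N_i` and `d_i ∣ (Mn + c)_i` for all `i`
is at most `(2Cm/D)^m ∏ N_i`. -/
theorem geometry_of_numbers_counting (m : ℕ) (C : ℝ) (hC : 1 ≤ C)
    (M : Matrix (Fin m) (Fin m) ℤ) (hdet : M.det ≠ 0)
    (hMC : ∀ i j, |(M i j : ℝ)| ≤ C)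
    (c : Fin m → ℤ) (D : ℝ) (hD : 1 ≤ D)
    (d : Fin m → ℤ) (hd : ∀ i, D ≤ (d i : ℝ))
    (N : Fin m → ℝ) (hN : ∀ i, D ≤ N i) :
    (({n : Fin m → ℤ |
        (∀ i, N i ≤ (n i : ℝ) ∧ (n i : ℝ) ≤ 2 * N i) ∧
        (∀ i, d i ∣ (M.mulVec n + c) i)}.ncard : ℝ)) ≤
      (2 * C * m / D) ^ m * ∏ i, N i := by
  set K : ℝ := C * m / D with hK
  have hD0 : 0 < D := by linarith
  have hC0 : 0 < C := by linarith
  set S : Set (Fin m → ℤ) := {n : Fin m → ℤ |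
        (∀ i, N i ≤ (n i : ℝ) ∧ (n i : ℝ) ≤ 2 * N i) ∧
        (∀ i, d i ∣ (M.mulVec n + c) i)} with hS
  let f : (Fin m → ℤ) → (Fin m → ℕ) := fun n i => ⌊((n i : ℝ) - N i) * K⌋₊
  let T : Finset (Fin m → ℕ) := Fintype.piFinset fun i => Finset.range (⌊N i * K⌋₊ + 1)
  have hK0 : 0 ≤ K := by positivity
  have hmaps : ∀ n ∈ S, f n ∈ (T : Set (Fin m → ℕ)) := by
    intro n hn
    simp only [T, f, Finset.mem_coe, Fintype.mem_piFinset, Finset.mem_range]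
    intro i
    refine Nat.lt_succ_of_le (Nat.floor_le_floor ?_)
    exact mul_le_mul_of_nonneg_right (by linarith [(hn.1 i).2]) hK0
  have hinj : Set.InjOn f S := by
    intro n hn n' hn' hff
    have hsub : M.mulVec (n - n') = 0 := by
      funext i
      have hm : (0 : ℝ) < m := by exact_mod_cast i.pos
      have hKpos : 0 < K := by positivity
      have hdvd : d i ∣ M.mulVec (n - n') i := by
        have := dvd_sub (hn.2 i) (hn'.2 i)
        rw [Matrix.mulVec_sub]
        simpa using this
      have hdiff : ∀ j, |((n j : ℝ) - n' j)| < 1 / K := by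
        intro j
        have h0 : ⌊((n j : ℝ) - N j) * K⌋₊ = ⌊((n' j : ℝ) - N j) * K⌋₊ := congrFun hff j
        have a0 : 0 ≤ ((n j : ℝ) - N j) * K :=
          mul_nonneg (by linarith [(hn.1 j).1]) hK0
        have b0 : 0 ≤ ((n' j : ℝ) - N j) * K :=
          mul_nonneg (by linarith [(hn'.1 j).1]) hK0
        have a1 := Nat.floor_le a0
        have a2 := Nat.lt_floor_add_one (((n j : ℝ) - N j) * K)
        have b1 := Nat.floor_le b0
        have b2 := Nat.lt_floor_add_one (((n' j : ℝ) - N j) * K)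
        rw [h0] at a1 a2
        rw [lt_div_iff₀ hKpos]
        have e : |((n j : ℝ) - n' j)| * K = |((n j : ℝ) - n' j) * K| := by
          rw [abs_mul, abs_of_pos hKpos]
        rw [e, abs_lt]
        constructor <;> linarith
      have hlt : |((M.mulVec (n - n') i : ℤ) : ℝ)| < D := by
        have e : ((M.mulVec (n - n') i : ℤ) : ℝ) = ∑ j, (M i j : ℝ) * ((n j : ℝ) - n' j) := by
          simp [Matrix.mulVec, dotProduct]
        rw [e]
        calc |∑ j, (M i j : ℝ) * ((n j : ℝ) - n' j)|
            ≤ ∑ j, |(M i j : ℝ) * ((n j : ℝ) - n' j)| := Finset.abs_sum_le_sum_abs _ _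
          _ ≤ ∑ j : Fin m, C * |((n j : ℝ) - n' j)| := by
              refine Finset.sum_le_sum fun j _ => ?_
              rw [abs_mul]
              exact mul_le_mul_of_nonneg_right (hMC i j) (abs_nonneg _)
          _ < ∑ j : Fin m, C * (1 / K) := by
              refine Finset.sum_lt_sum_of_nonempty ⟨i, Finset.mem_univ i⟩ fun j _ => ?_
              exact mul_lt_mul_of_pos_left (hdiff j) hC0
          _ = D := by
              simp only [Finset.sum_const, Finset.card_univ, Fintype.card_fin, nsmul_eq_mul, hK]
              field_simp
      refine Int.eq_zero_of_abs_lt_dvd hdvd ?_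
      have : |((M.mulVec (n - n') i : ℤ) : ℝ)| < (d i : ℝ) := lt_of_lt_of_le hlt (hd i)
      exact_mod_cast this
    exact sub_eq_zero.mp (Matrix.eq_zero_of_mulVec_eq_zero hdet hsub)
  have hcard : S.ncard ≤ T.card := by
    rw [← Set.ncard_coe_finset T]
    exact Set.ncard_le_ncard_of_injOn f hmaps hinj T.finite_toSet
  calc (S.ncard : ℝ) ≤ (T.card : ℝ) := by exact_mod_cast hcard
    _ = ∏ i, ((⌊N i * K⌋₊ : ℝ) + 1) := by simp [T]
    _ ≤ ∏ i, ((2 * C * m / D) * N i) := by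
        refine Finset.prod_le_prod (fun i _ => by positivity) fun i _ => ?_
        have hm : (1 : ℝ) ≤ m := by exact_mod_cast i.pos
        have hNi : 0 ≤ N i := by linarith [hN i]
        have h1 : (⌊N i * K⌋₊ : ℝ) ≤ N i * K := Nat.floor_le (mul_nonneg hNi hK0)
        have h2 : 1 ≤ N i * K := by
          rw [hK, ← mul_div_assoc, one_le_div hD0]
          have : 1 ≤ C * m := one_le_mul_of_one_le_of_one_le hC hm
          nlinarith [hN i]
        have h3 : (2 * C * m / D) * N i = 2 * (N i * K) := by rw [hK]; ring
        linarith
    _ = (2 * C * m / D) ^ m * ∏ i, N i := by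
        rw [Finset.prod_mul_distrib, Finset.prod_const, Finset.card_univ, Fintype.card_fin]
end

section
/- Rank lemma: Let A be a matrix over a field with n rows such that every row has at least one non-zero entry and no column has more than κ non-zero entries, where κ ≥ 1 is an integer. Then rank(A) ≥ n/κ. -/
/-- Rank lemma: if every row of a matrix `A` over a field has a non-zero entry and every
column has at most `κ` non-zero entries, then `rank(A) ≥ n/κ`, where `n` is the number of
rows. -/
theorem rank_ge_rows_div_kappa {F : Type*} [Field F] {n m : ℕ} (κ : ℕ) (hκ : 1 ≤ κ)
    (A : Matrix (Fin n) (Fin m) F)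
    (hrow : ∀ i, ∃ j, A i j ≠ 0)
    (hcol : ∀ j, {i : Fin n | A i j ≠ 0}.ncard ≤ κ) :
    (n : ℝ) / (κ : ℝ) ≤ (A.rank : ℝ) := by
  classical
  obtain ⟨b, hbt, hspan, hli⟩ := exists_linearIndependent F (Set.range A.col)
  have hbfin : b.Finite := (Set.finite_range A.col).subset hbt
  have : Fintype b := hbfin.fintype
  have hrank : A.rank = b.toFinset.card := by
    rw [Matrix.rank_eq_finrank_span_cols, ← hspan, finrank_span_set_eq_card hli]
  have hcover : (Finset.univ : Finset (Fin n)) ⊆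
      b.toFinset.biUnion (fun v => Finset.univ.filter (fun i => v i ≠ 0)) := by
    intro i _
    by_contra hcon
    have hz : ∀ v ∈ b, v i = 0 := by
      intro v hv
      by_contra hvi
      exact hcon (Finset.mem_biUnion.2 ⟨v, by simpa using hv, by simpa using hvi⟩)
    have hle : Submodule.span F b ≤ LinearMap.ker (LinearMap.proj (R := F) (φ := fun _ : Fin n => F) i) := by
      rw [Submodule.span_le]
      intro v hv
      simpa using hz v hv
    obtain ⟨j, hj⟩ := hrow i
    have hm : A.col j ∈ Submodule.span F b := by
      rw [hspan]
      exact Submodule.subset_span ⟨j, rfl⟩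
    have := hle hm
    exact hj (by simpa using this)
  have hn : n ≤ A.rank * κ := by
    have h1 := Finset.card_le_card hcover
    rw [Finset.card_univ, Fintype.card_fin] at h1
    rw [hrank]
    refine h1.trans (Finset.card_biUnion_le_card_mul _ _ _ ?_)
    intro v hv
    obtain ⟨j, rfl⟩ := hbt (by simpa using hv)
    have := hcol j
    rw [Set.ncard_eq_toFinset_card'] at this
    refine le_trans (Finset.card_le_card ?_) this
    intro i hi
    exact Set.mem_toFinset.2 (Finset.mem_filter.1 hi).2
  rw [div_le_iff₀ (by exact_mod_cast hκ)]
  exact_mod_cast hn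
end

section
/- Kleitman–West spanning tree theorem: Let 𝒢 be a connected finite simple graph with n vertices, each of degree ≥ 3. Then 𝒢 has a spanning tree with at least n/4 + 2 leaves. -/
namespace KW
open Finset Classical

variable {V : Type*} [Fintype V]

noncomputable def nb (G : SimpleGraph V) (v : V) : Finset V := univ.filter (fun w => G.Adj v w)

noncomputable def cN (G : SimpleGraph V) (I : Finset V) : Finset V :=
  univ.filter (fun v => v ∈ I ∨ ∃ u ∈ I, G.Adj u v)

noncomputable def dd (G : SimpleGraph V) (I : Finset V) : Finset V :=
  univ.filter (fun v => v ∈ cN G I ∧ v ∉ I ∧ ∀ w, G.Adj v w → w ∈ cN G I)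

noncomputable def out (G : SimpleGraph V) (I : Finset V) (x : V) : Finset V :=
  univ.filter (fun w => G.Adj x w ∧ w ∉ cN G I)

noncomputable def phi (G : SimpleGraph V) (I : Finset V) : ℤ :=
  2 * ((cN G I).card : ℤ) - 3 * (I.card : ℤ) + ((dd G I).card : ℤ)

inductive Grow (G : SimpleGraph V) : Finset V → Prop
  | single (v : V) : Grow G {v}
  | step (I : Finset V) (x : V) : Grow G I → x ∈ cN G I → x ∉ I → Grow G (insert x I)

lemma mem_nb {G : SimpleGraph V} {v w : V} : w ∈ nb G v ↔ G.Adj v w := by simp [nb]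
lemma mem_cN {G : SimpleGraph V} {I : Finset V} {v : V} :
    v ∈ cN G I ↔ v ∈ I ∨ ∃ u ∈ I, G.Adj u v := by simp [cN]
lemma mem_dd {G : SimpleGraph V} {I : Finset V} {v : V} :
    v ∈ dd G I ↔ v ∈ cN G I ∧ v ∉ I ∧ ∀ w, G.Adj v w → w ∈ cN G I := by simp [dd]
lemma mem_out {G : SimpleGraph V} {I : Finset V} {x v : V} :
    v ∈ out G I x ↔ G.Adj x v ∧ v ∉ cN G I := by simp [out]

lemma cN_insert {G : SimpleGraph V} {I : Finset V} {x : V} (hx : x ∈ cN G I) :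
    cN G (insert x I) = cN G I ∪ out G I x := by
  ext v
  rw [mem_union, mem_out]
  constructor
  · intro h
    by_cases hv : v ∈ cN G I
    · exact Or.inl hv
    · right
      refine ⟨?_, hv⟩
      rw [mem_cN] at h
      rcases h with h | ⟨u, hu, h⟩
      · rcases mem_insert.1 h with rfl | h
        · exact absurd hx hv
        · exact absurd (mem_cN.2 (Or.inl h)) hv
      · rcases mem_insert.1 hu with rfl | hu
        · exact h
        · exact absurd (mem_cN.2 (Or.inr ⟨u, hu, h⟩)) hv
  · rintro (h | ⟨h, -⟩)
    · rw [mem_cN] at h ⊢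
      rcases h with h | ⟨u, hu, h⟩
      · exact Or.inl (mem_insert_of_mem h)
      · exact Or.inr ⟨u, mem_insert_of_mem hu, h⟩
    · exact mem_cN.2 (Or.inr ⟨x, mem_insert_self _ _, h⟩)

lemma card_cN_insert {G : SimpleGraph V} {I : Finset V} {x : V} (hx : x ∈ cN G I) :
    (cN G (insert x I)).card = (cN G I).card + (out G I x).card := by
  rw [cN_insert hx, card_union_of_disjoint]
  rw [Finset.disjoint_left]
  intro a ha hb
  exact (mem_out.1 hb).2 ha

lemma dd_mono {G : SimpleGraph V} {I : Finset V} {x : V} (hx : x ∈ cN G I)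
    (ho : (out G I x).Nonempty) : dd G I ⊆ dd G (insert x I) := by
  intro v hv
  obtain ⟨h1, h2, h3⟩ := mem_dd.1 hv
  rw [mem_dd, cN_insert hx]
  refine ⟨mem_union_left _ h1, ?_, fun w hw => mem_union_left _ (h3 w hw)⟩
  intro h
  rcases mem_insert.1 h with rfl | h
  · obtain ⟨w, hw⟩ := ho
    exact (mem_out.1 hw).2 (h3 w (mem_out.1 hw).1)
  · exact h2 h

lemma phi_insert {G : SimpleGraph V} {I : Finset V} {x : V} (hx : x ∈ cN G I) (hxI : x ∉ I)
    (ho : (out G I x).Nonempty) (S : Finset V) (hS : Disjoint (dd G I) S)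
    (hS' : S ⊆ dd G (insert x I)) :
    phi G I + 2 * ((out G I x).card : ℤ) - 3 + (S.card : ℤ) ≤ phi G (insert x I) := by
  have h1 := card_cN_insert hx
  have h2 := card_le_card (union_subset (dd_mono hx ho) hS')
  rw [card_union_of_disjoint hS] at h2
  have h3 := card_insert_of_notMem hxI
  unfold phi
  rw [h1, h3]
  push_cast
  have : ((dd G I).card : ℤ) + S.card ≤ (dd G (insert x I)).card := by exact_mod_cast h2
  linarith

lemma phi_insert_final {G : SimpleGraph V} {I : Finset V} {x : V} (hx : x ∈ cN G I) (hxI : x ∉ I)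
    (ho : (out G I x).Nonempty) (hu : cN G (insert x I) = univ) :
    phi G I + 3 * ((out G I x).card : ℤ) - 3 ≤ phi G (insert x I) := by
  have := phi_insert hx hxI ho (out G I x) (by
    rw [Finset.disjoint_left]
    intro a ha hb
    exact (mem_out.1 hb).2 (mem_dd.1 ha).1) (by
    intro v hv
    rw [mem_dd, hu]
    refine ⟨mem_univ _, ?_, fun _ _ => mem_univ _⟩
    intro h
    rcases mem_insert.1 h with rfl | h
    · exact G.loopless.irrefl _ (mem_out.1 hv).1
    · exact (mem_out.1 hv).2 (mem_cN.2 (Or.inl h)))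
  linarith

lemma phi_univ {G : SimpleGraph V} {I : Finset V} (hu : cN G I = univ) :
    phi G I = 3 * (Fintype.card V : ℤ) - 4 * (I.card : ℤ) := by
  have : dd G I = univ \ I := by
    ext v
    simp [mem_dd, hu]
  have h2 : (dd G I).card + I.card = Fintype.card V := by
    rw [this, card_sdiff_add_card_eq_card (subset_univ _), card_univ]
  unfold phi
  rw [hu, card_univ]
  have : ((dd G I).card : ℤ) + I.card = Fintype.card V := by exact_mod_cast h2
  linarith

lemma exists_border {G : SimpleGraph V} (hc : G.Connected) {S : Finset V} (hne : S.Nonempty)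
    (hS : S ≠ univ) : ∃ x ∈ S, ∃ y, y ∉ S ∧ G.Adj x y := by
  by_contra hcon
  push Not at hcon
  apply hS
  obtain ⟨r, hr⟩ := hne
  ext y
  simp only [mem_univ, iff_true]
  obtain ⟨p⟩ := hc.preconnected r y
  induction p with
  | nil => exact hr
  | cons h p ih =>
    apply ih
    by_contra hh
    exact hcon _ hr _ hh h

lemma Grow.nonempty {G : SimpleGraph V} {I : Finset V} (h : Grow G I) : I.Nonempty := by
  cases h <;> simp

lemma step {G : SimpleGraph V} (hc : G.Connected) (hd : ∀ v, 3 ≤ (nb G v).card)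
    {I : Finset V} (hI : Grow G I) (hu : cN G I ≠ univ) :
    ∃ J, Grow G J ∧ (cN G I).card < (cN G J).card ∧ phi G I ≤ phi G J ∧
      (cN G J = univ → phi G I + 2 ≤ phi G J) := by
  have hnI : ∀ x, (out G I x).Nonempty → x ∉ I := by
    rintro x ⟨w, hw⟩ hx
    exact (mem_out.1 hw).2 (mem_cN.2 (Or.inr ⟨x, hx, (mem_out.1 hw).1⟩))
  by_cases h1 : ∃ x ∈ cN G I, 2 ≤ (out G I x).card
  · obtain ⟨x, hx, h2⟩ := h1
    have ho : (out G I x).Nonempty := card_pos.1 (by omega)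
    have hxI := hnI x ho
    refine ⟨insert x I, Grow.step I x hI hx hxI, ?_, ?_, ?_⟩
    · rw [card_cN_insert hx]; omega
    · have := phi_insert hx hxI ho ∅ (by simp) (by simp)
      simp only [card_empty] at this
      push_cast at this
      linarith [(by exact_mod_cast h2 : (2:ℤ) ≤ ((out G I x).card : ℤ))]
    · intro hf
      have := phi_insert_final hx hxI ho hf
      linarith [(by exact_mod_cast h2 : (2:ℤ) ≤ ((out G I x).card : ℤ))]
  · push Not at h1
    have hne : (cN G I).Nonempty := by
      obtain ⟨r, hr⟩ := hI.nonempty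
      exact ⟨r, mem_cN.2 (Or.inl hr)⟩
    obtain ⟨x, hx, y, hy, hxy⟩ := exists_border hc hne hu
    have hyo : y ∈ out G I x := mem_out.2 ⟨hxy, hy⟩
    have ho : (out G I x).Nonempty := ⟨y, hyo⟩
    have hxI := hnI x ho
    have hk : (out G I x).card = 1 := by
      have := h1 x hx
      have := card_pos.2 ho
      omega
    have hJ := Grow.step I x hI hx hxI
    have hone : ∀ z ∈ cN G I, G.Adj z y → ∀ w, G.Adj z w → w ∉ cN G I → w = y := by
      intro z hz hzy w hzw hw
      have : (out G I z).card ≤ 1 := by have := h1 z hz; omega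
      exact card_le_one.1 this w (mem_out.2 ⟨hzw, hw⟩) y (mem_out.2 ⟨hzy, hy⟩)
    have hyI : y ∉ I := fun h => hy (mem_cN.2 (Or.inl h))
    have hnbI : ∀ z, G.Adj y z → z ∉ I := fun z hz h => hy (mem_cN.2 (Or.inr ⟨z, h, hz.symm⟩))
    by_cases h2 : ∃ z ∈ cN G I, z ≠ x ∧ G.Adj z y
    · obtain ⟨z, hz, hzx, hzy⟩ := h2
      refine ⟨insert x I, hJ, ?_, ?_, ?_⟩
      · rw [card_cN_insert hx]; omega
      · have := phi_insert hx hxI ho {z} (by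
          rw [disjoint_singleton_right]
          intro h
          exact hy ((mem_dd.1 h).2.2 y hzy)) (by
          rw [singleton_subset_iff, mem_dd, cN_insert hx]
          refine ⟨mem_union_left _ hz, ?_, ?_⟩
          · intro h
            rcases mem_insert.1 h with h | h
            · exact hzx h
            · exact hnbI z hzy.symm h
          · intro w hw
            by_cases hwc : w ∈ cN G I
            · exact mem_union_left _ hwc
            · rw [hone z hz hzy w hw hwc]
              exact mem_union_right _ hyo)
        simp only [card_singleton, hk] at this
        push_cast at this
        linarith
      · intro hf
        have := phi_insert hx hxI ho (insert y ((nb G y).erase x)) (by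
          rw [Finset.disjoint_left]
          intro a ha hb
          rcases mem_insert.1 hb with rfl | hb
          · exact hy (mem_dd.1 ha).1
          · exact hy ((mem_dd.1 ha).2.2 y (mem_nb.1 (mem_of_mem_erase hb)).symm)) (by
          intro a ha
          rw [mem_dd, hf]
          refine ⟨mem_univ _, ?_, fun _ _ => mem_univ _⟩
          intro hb
          rcases mem_insert.1 ha with rfl | ha
          · rcases mem_insert.1 hb with rfl | hb
            · exact hy hx
            · exact hyI hb
          · rcases mem_insert.1 hb with rfl | hb
            · simp at ha
            · exact hnbI a (mem_nb.1 (mem_of_mem_erase ha)) hb)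
        have hc1 : (insert y ((nb G y).erase x)).card = (nb G y).card := by
          rw [card_insert_of_notMem, card_erase_of_mem (mem_nb.2 hxy.symm)]
          · have := hd y; omega
          · intro h
            exact G.loopless.irrefl _ (mem_nb.1 (mem_of_mem_erase h))
        rw [hc1, hk] at this
        push_cast at this
        have := hd y
        omega
    · push Not at h2
      have hcN : cN G (insert x I) = insert y (cN G I) := by
        rw [cN_insert hx]
        have : out G I x = {y} := by
          obtain ⟨a, ha⟩ := card_eq_one.1 hk
          rw [ha] at hyo ⊢
          rw [mem_singleton.1 hyo]
        rw [this]
        ext; simp [or_comm]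
      have hyc : y ∈ cN G (insert x I) := by rw [hcN]; exact mem_insert_self _ _
      have hyI' : y ∉ insert x I := by
        intro h
        rcases mem_insert.1 h with rfl | h
        · exact hy hx
        · exact hyI h
      have hk2 : 2 ≤ (out G (insert x I) y).card := by
        have hs : (nb G y).erase x ⊆ out G (insert x I) y := by
          intro z hz
          have hz1 := mem_nb.1 (mem_of_mem_erase hz)
          rw [mem_out, hcN]
          refine ⟨hz1, ?_⟩
          intro h
          rcases mem_insert.1 h with rfl | h
          · exact G.loopless.irrefl _ hz1
          · exact h2 z h (ne_of_mem_erase hz) hz1.symm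
        have := card_le_card hs
        rw [card_erase_of_mem (mem_nb.2 hxy.symm)] at this
        have := hd y
        omega
      have ho2 : (out G (insert x I) y).Nonempty := card_pos.1 (by omega)
      have hz2 : (2:ℤ) ≤ ((out G (insert x I) y).card : ℤ) := by exact_mod_cast hk2
      have hp1 := phi_insert hx hxI ho ∅ (by simp) (by simp)
      rw [hk] at hp1
      simp only [card_empty] at hp1
      push_cast at hp1
      refine ⟨insert y (insert x I), Grow.step _ y hJ hyc hyI', ?_, ?_, ?_⟩
      · rw [card_cN_insert hyc, card_cN_insert hx]; omega
      · have hp2 := phi_insert hyc hyI' ho2 ∅ (by simp) (by simp)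
        simp only [card_empty] at hp2
        push_cast at hp2
        linarith
      · intro hf
        have hp2 := phi_insert_final hyc hyI' ho2 hf
        linarith

lemma finish {G : SimpleGraph V} (hc : G.Connected) (hd : ∀ v, 3 ≤ (nb G v).card) (m : ℕ) :
    ∀ I : Finset V, Fintype.card V - (cN G I).card = m → Grow G I → cN G I ≠ univ →
    ∃ J, Grow G J ∧ cN G J = univ ∧ phi G I + 2 ≤ phi G J := by
  induction m using Nat.strong_induction_on with
  | _ m ih =>
    intro I hm hI hu
    obtain ⟨J, hJ, h1, h2, h3⟩ := step hc hd hI hu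
    by_cases hJu : cN G J = univ
    · exact ⟨J, hJ, hJu, h3 hJu⟩
    · have hle := card_le_univ (cN G J)
      obtain ⟨K, hK, hKu, h4⟩ := ih _ (by omega) J rfl hJ hJu
      exact ⟨K, hK, hKu, by linarith⟩

lemma cN_single {G : SimpleGraph V} (v : V) : cN G {v} = insert v (nb G v) := by
  ext w
  simp [mem_cN, mem_nb]

lemma card_cN_single {G : SimpleGraph V} (v : V) : (cN G {v}).card = (nb G v).card + 1 := by
  rw [cN_single, card_insert_of_notMem]
  intro h
  exact G.loopless.irrefl _ (mem_nb.1 h)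

lemma tri {G : SimpleGraph V} (hd : ∀ v, 3 ≤ (nb G v).card) {u x : V} (hux : G.Adj u x)
    (h : (out G {u} x).card ≤ 1) : ∃ z, G.Adj u z ∧ G.Adj x z := by
  by_contra hcon
  push Not at hcon
  have hs : (nb G x).erase u ⊆ out G {u} x := by
    intro z hz
    have hz1 := mem_nb.1 (mem_of_mem_erase hz)
    rw [mem_out, cN_single]
    refine ⟨hz1, ?_⟩
    intro h
    rcases mem_insert.1 h with h | h
    · exact ne_of_mem_erase hz h
    · exact hcon z (mem_nb.1 h) hz1
  have := card_le_card hs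
  rw [card_erase_of_mem (mem_nb.2 hux.symm)] at this
  have := hd x
  omega

lemma three {G : SimpleGraph V} {a p q r s : V} (h3 : (nb G a).card ≤ 3)
    (hp : G.Adj a p) (hq : G.Adj a q) (hr : G.Adj a r) (hs : G.Adj a s)
    (hpq : p ≠ q) (hpr : p ≠ r) (hqr : q ≠ r) : s = p ∨ s = q ∨ s = r := by
  have hsub : ({p, q, r} : Finset V) ⊆ nb G a := by
    intro z hz
    simp only [mem_insert, mem_singleton] at hz
    rcases hz with rfl | rfl | rfl <;> exact mem_nb.2 ‹_›
  have hc : ({p, q, r} : Finset V).card = 3 := card_eq_three.2 ⟨p, q, r, hpq, hpr, hqr, rfl⟩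
  have := eq_of_subset_of_card_le hsub (by omega)
  have h := mem_nb.2 hs
  rw [← this] at h
  simpa using h

lemma exists_third {G : SimpleGraph V} {v : V} (a b : V) (h3 : 3 ≤ (nb G v).card) :
    ∃ c, G.Adj v c ∧ c ≠ a ∧ c ≠ b := by
  by_contra hcon
  push Not at hcon
  have hs : nb G v ⊆ {a, b} := by
    intro c hc
    simp only [mem_insert, mem_singleton]
    by_cases h : c = a
    · exact Or.inl h
    · exact Or.inr (hcon c (mem_nb.1 hc) h)
  have := card_le_card hs
  have := card_le_two (a := a) (b := b)
  omega

lemma cubic_start {G : SimpleGraph V} (hc : G.Connected) (hd : ∀ v, 3 ≤ (nb G v).card)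
    (hd' : ∀ v, (nb G v).card ≤ 3) (v : V) (hv : cN G {v} ≠ univ) :
    ∃ u x, G.Adj u x ∧ 2 ≤ (out G {u} x).card := by
  by_contra hcon
  push Not at hcon
  have ht : ∀ u x, G.Adj u x → ∃ z, G.Adj u z ∧ G.Adj x z := fun u x h =>
    tri hd h (by have := hcon u x h; omega)
  obtain ⟨a, ha, w, hw, haw⟩ := exists_border hc (S := cN G {v}) ⟨v, by simp [mem_cN]⟩ hv
  simp only [mem_cN, mem_singleton, exists_eq_left, not_or] at ha hw
  obtain ⟨hwv, hvw⟩ := hw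
  have hva : G.Adj v a := by
    rcases ha with rfl | ha
    · exact absurd haw hvw
    · exact ha
  obtain ⟨b, hab, hwb⟩ := ht a w haw
  have hbv : b ≠ v := by rintro rfl; exact hvw hwb.symm
  have hbw : b ≠ w := hwb.ne'
  obtain ⟨b', hab', hvb'⟩ := ht a v hva.symm
  have hvb : G.Adj v b := by
    rcases three (hd' a) hva.symm haw hab hab' (Ne.symm hwv) hbv.symm hbw.symm with rfl | rfl | rfl
    · exact absurd hvb' (G.loopless.irrefl _)
    · exact absurd hvb' hvw
    · exact hvb'
  obtain ⟨c, hvc, hca, hcb⟩ := exists_third a b (hd v)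
  have hcw : c ≠ w := by rintro rfl; exact hvw hvc
  obtain ⟨z, hvz, hcz⟩ := ht v c hvc
  rcases three (hd' v) hva hvb hvc hvz hab.ne hca.symm hcb.symm with rfl | rfl | rfl
  · rcases three (hd' z) hva.symm haw hab hcz.symm (Ne.symm hwv) hbv.symm hbw.symm with h | h | h
    · exact hvc.ne' h
    · exact hcw h
    · exact hcb h
  · rcases three (hd' z) hvb.symm hab.symm hwb.symm hcz.symm hva.ne (Ne.symm hwv) haw.ne
      with h | h | h
    · exact hvc.ne' h
    · exact hca h
    · exact hcw h
  · exact G.loopless.irrefl _ hcz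

lemma phi_single_ge {G : SimpleGraph V} (v : V) :
    2 * ((nb G v).card : ℤ) - 1 ≤ phi G {v} := by
  unfold phi
  rw [card_cN_single, card_singleton]
  push_cast
  have : (0:ℤ) ≤ ((dd G {v}).card : ℤ) := by positivity
  linarith

lemma exists_good {G : SimpleGraph V} (hc : G.Connected) (hd : ∀ v, 3 ≤ (nb G v).card) :
    ∃ J, Grow G J ∧ cN G J = univ ∧ 8 ≤ phi G J := by
  have hsp : ∀ v, cN G {v} = univ → ∃ J, Grow G J ∧ cN G J = univ ∧ 8 ≤ phi G J := by
    intro v hv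
    refine ⟨{v}, Grow.single v, hv, ?_⟩
    have h1 := card_cN_single (G := G) v
    rw [hv, card_univ] at h1
    rw [phi_univ hv, h1, card_singleton]
    push_cast
    have := hd v
    omega
  by_cases h4 : ∃ v, 4 ≤ (nb G v).card
  · obtain ⟨v, h4⟩ := h4
    by_cases hv : cN G {v} = univ
    · exact hsp v hv
    · obtain ⟨J, hJ, hJu, h⟩ := finish hc hd _ {v} rfl (Grow.single v) hv
      refine ⟨J, hJ, hJu, ?_⟩
      linarith [phi_single_ge (G := G) v, (by exact_mod_cast h4 : (4:ℤ) ≤ ((nb G v).card : ℤ))]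
  · push Not at h4
    obtain ⟨v⟩ := hc.nonempty
    by_cases hv : cN G {v} = univ
    · exact hsp v hv
    · obtain ⟨u, x, hux, h2⟩ := cubic_start hc hd (fun v => by have := h4 v; omega) v hv
      have hx : x ∈ cN G {u} := by simp [mem_cN, hux]
      have hxI : x ∉ ({u} : Finset V) := by simpa using hux.ne'
      have ho : (out G {u} x).Nonempty := card_pos.1 (by omega)
      have hz2 : (2:ℤ) ≤ ((out G {u} x).card : ℤ) := by exact_mod_cast h2
      have hg := Grow.step _ x (Grow.single u) hx hxI
      have hs := phi_single_ge (G := G) u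
      have h3 : (3:ℤ) ≤ ((nb G u).card : ℤ) := by exact_mod_cast hd u
      by_cases hf : cN G (insert x {u}) = univ
      · refine ⟨_, hg, hf, ?_⟩
        have := phi_insert_final hx hxI ho hf
        linarith
      · obtain ⟨J, hJ, hJu, h⟩ := finish hc hd _ _ rfl hg hf
        refine ⟨J, hJ, hJu, ?_⟩
        have := phi_insert hx hxI ho ∅ (by simp) (by simp)
        simp only [card_empty] at this
        push_cast at this
        linarith

def ins (G : SimpleGraph V) (I : Finset V) : SimpleGraph V where
  Adj a b := G.Adj a b ∧ a ∈ I ∧ b ∈ I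
  symm := ⟨fun _ _ h => ⟨h.1.symm, h.2.2, h.2.1⟩⟩
  loopless := ⟨fun _ h => G.loopless.irrefl _ h.1⟩

lemma Grow.reach {G : SimpleGraph V} {I : Finset V} (h : Grow G I) :
    ∃ r ∈ I, ∀ x ∈ I, (ins G I).Reachable r x := by
  induction h with
  | single v =>
    refine ⟨v, by simp, ?_⟩
    intro x hx
    rw [mem_singleton.1 hx]
  | step I x hI hx hxI ih =>
    obtain ⟨r, hr, ih⟩ := ih
    have hle : ins G I ≤ ins G (insert x I) := by
      intro a b hab
      exact ⟨hab.1, mem_insert_of_mem hab.2.1, mem_insert_of_mem hab.2.2⟩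
    refine ⟨r, mem_insert_of_mem hr, ?_⟩
    intro y hy
    rcases mem_insert.1 hy with rfl | hy
    · rcases mem_cN.1 hx with h | ⟨u, hu, h⟩
      · exact absurd h hxI
      · refine ((ih u hu).mono hle).trans (SimpleGraph.Adj.reachable ?_)
        exact ⟨h, mem_insert_of_mem hu, mem_insert_self _ _⟩
    · exact (ih y hy).mono hle

lemma exists_tree {G : SimpleGraph V} {I : Finset V} (h : Grow G I) (hu : cN G I = univ)
    (hnt : Nontrivial V) :
    ∃ T : SimpleGraph V, T ≤ G ∧ T.Connected ∧ T.IsAcyclic ∧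
      ∀ v, v ∉ I → (T.neighborSet v).ncard = 1 := by
  have hf : ∀ v, ∃ u, v ∉ I → (u ∈ I ∧ G.Adj u v) := by
    intro v
    have hv : v ∈ cN G I := hu ▸ mem_univ v
    rcases mem_cN.1 hv with hv | ⟨u, h1, h2⟩
    · exact ⟨v, fun h => absurd hv h⟩
    · exact ⟨u, fun _ => ⟨h1, h2⟩⟩
  choose f hf using hf
  let H : SimpleGraph V :=
    { Adj := fun a b => G.Adj a b ∧ ((a ∈ I ∧ b ∈ I) ∨ (a ∉ I ∧ b = f a) ∨ (b ∉ I ∧ a = f b))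
      symm := ⟨fun a b h => ⟨h.1.symm, by tauto⟩⟩
      loopless := ⟨fun _ h => G.loopless.irrefl _ h.1⟩ }
  obtain ⟨r, hr, hreach⟩ := h.reach
  have hle : ins G I ≤ H := fun a b hab => ⟨hab.1, Or.inl hab.2⟩
  have hall : ∀ v, H.Reachable r v := by
    intro v
    by_cases hv : v ∈ I
    · exact (hreach v hv).mono hle
    · refine ((hreach (f v) (hf v hv).1).mono hle).trans (SimpleGraph.Adj.reachable ?_)
      exact ⟨(hf v hv).2, Or.inr (Or.inr ⟨hv, rfl⟩)⟩
  have hH : H.Connected := by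
    haveI : Nonempty V := ⟨r⟩
    exact ⟨fun a b => (hall a).symm.trans (hall b)⟩
  obtain ⟨T, hTH, hT⟩ := hH.exists_isTree_le
  refine ⟨T, fun a b hab => (hTH hab).1, hT.connected, hT.isAcyclic, ?_⟩
  intro v hv
  rw [Set.ncard_eq_one]
  refine ⟨f v, ?_⟩
  have hsub : ∀ w, T.Adj v w → w = f v := by
    intro w hw
    rcases (hTH hw).2 with h | h | h
    · exact absurd h.1 hv
    · exact h.2
    · exact absurd (h.2 ▸ (hf w h.1).1) hv
  obtain ⟨w, hw⟩ := hT.connected.preconnected.exists_adj_of_nontrivial v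
  ext z
  simp only [SimpleGraph.mem_neighborSet, Set.mem_singleton_iff]
  constructor
  · exact hsub z
  · rintro rfl
    exact hsub w hw ▸ hw

end KW

/-- Kleitman–West spanning tree theorem: a connected finite simple graph all of whose
vertices have degree at least 3 has a spanning tree with at least `n/4 + 2` leaves,
where `n` is the number of vertices. -/
theorem kleitman_west {V : Type*} [Fintype V] (G : SimpleGraph V) [DecidableRel G.Adj]
    (hconn : G.Connected) (hdeg : ∀ v, 3 ≤ G.degree v) :
    ∃ T : SimpleGraph V, T ≤ G ∧ T.Connected ∧ T.IsAcyclic ∧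
      (Fintype.card V : ℝ) / 4 + 2 ≤ ({v : V | (T.neighborSet v).ncard = 1}.ncard : ℝ) := by
  classical
  have hd : ∀ v, 3 ≤ (KW.nb G v).card := by
    intro v
    have : KW.nb G v = G.neighborFinset v := by
      ext w; simp [KW.mem_nb]
    rw [this]
    exact hdeg v
  obtain ⟨J, hJ, hJu, h8⟩ := KW.exists_good hconn hd
  have hnt : Nontrivial V := by
    obtain ⟨v⟩ := hconn.nonempty
    obtain ⟨c, hc, -, -⟩ := KW.exists_third v v (hd v)
    exact ⟨v, c, hc.ne⟩
  obtain ⟨T, h1, h2, h3, h4⟩ := KW.exists_tree hJ hJu hnt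
  refine ⟨T, h1, h2, h3, ?_⟩
  rw [KW.phi_univ hJu] at h8
  have hsub : ((Finset.univ \ J : Finset V) : Set V) ⊆ {v : V | (T.neighborSet v).ncard = 1} := by
    intro v hv
    exact h4 v (by simpa using hv)
  have hle := Set.ncard_le_ncard hsub (Set.toFinite _)
  rw [Set.ncard_coe_finset] at hle
  have hcard := Finset.card_sdiff_add_card_eq_card (Finset.subset_univ J)
  rw [Finset.card_univ] at hcard
  have hz : (Fintype.card V : ℤ) + 8 ≤ 4 * ({v : V | (T.neighborSet v).ncard = 1}.ncard : ℤ) := by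
    omega
  have hR : (Fintype.card V : ℝ) + 8 ≤ 4 * ({v : V | (T.neighborSet v).ncard = 1}.ncard : ℝ) := by
    exact_mod_cast hz
  linarith
end

section
/- Corollary to Kleitman–West: Let 𝒢 be a connected finite simple graph, and let n ≥ 1 be such that at least n of the vertices of 𝒢 have degree ≥ 3 in 𝒢. Then 𝒢 has a spanning tree with at least n/4 + 2 leaves. -/
namespace KW
variable {V : Type*} [Fintype V] [DecidableEq V] (G : SimpleGraph V) [DecidableRel G.Adj]

/-- `G` restricted to edges inside `I`. -/
def R (I : Finset V) : SimpleGraph V where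
  Adj u v := G.Adj u v ∧ u ∈ I ∧ v ∈ I
  symm := ⟨fun _ _ h => ⟨h.1.symm, h.2.2, h.2.1⟩⟩
  loopless := ⟨fun _ h => G.loopless.irrefl _ h.1⟩

structure Good (I A : Finset V) : Prop where
  disj : Disjoint I A
  conn : ∃ r ∈ I, ∀ i ∈ I, (R G I).Reachable r i
  dom : ∀ a ∈ A, ∃ i ∈ I, G.Adj a i
  closed : ∀ i ∈ I, ∀ v, G.Adj i v → v ∈ I ∪ A

def B : Finset V := Finset.univ.filter (fun v => 3 ≤ G.degree v)
def D (I A : Finset V) : Finset V := A.filter (fun a => ∀ v, G.Adj a v → v ∈ I ∪ A)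
def E (I A : Finset V) (x : V) : Finset V := G.neighborFinset x \ (I ∪ A)
def Phi (I A : Finset V) : ℤ := 3 * A.card + (D G I A).card - (B G ∩ (I ∪ A)).card

def P (I A : Finset V) (g : ℤ) : Prop :=
  ∃ I' A', Good G I' A' ∧ I' ∪ A' = Finset.univ ∧ I ⊆ I' ∧
    ((B G).card : ℤ) + Phi G I A + g ≤ 4 * A'.card

variable {G}

lemma R_mono {I J : Finset V} (h : I ⊆ J) : R G I ≤ R G J :=
  fun _ _ k => ⟨k.1, h k.2.1, h k.2.2⟩

lemma mem_E {I A : Finset V} {x v : V} : v ∈ E G I A x ↔ G.Adj x v ∧ v ∉ I ∪ A := by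
  simp [E]

lemma expand_union {I A : Finset V} {x : V} (hx : x ∈ A) :
    insert x I ∪ (A.erase x ∪ E G I A x) = (I ∪ A) ∪ E G I A x := by
  ext v
  simp only [Finset.mem_union, Finset.mem_insert, Finset.mem_erase]
  by_cases h : v = x
  · subst h; simp [hx]
  · simp [h, or_assoc]

lemma expand_good {I A : Finset V} {x : V} (h : Good G I A) (hx : x ∈ A) :
    Good G (insert x I) (A.erase x ∪ E G I A x) := by
  have hdis := Finset.disjoint_left.1 h.disj
  refine ⟨?_, ?_, ?_, ?_⟩
  · rw [Finset.disjoint_left]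
    intro v hv hv'
    simp only [Finset.mem_union, Finset.mem_insert, Finset.mem_erase, mem_E] at hv hv'
    rcases hv with rfl | hv
    · simp_all
    · have := hdis hv
      simp_all
  · obtain ⟨r, hr, hc⟩ := h.conn
    obtain ⟨i, hi, hxi⟩ := h.dom x hx
    have hm := R_mono (G := G) (Finset.subset_insert x I)
    refine ⟨r, Finset.mem_insert_of_mem hr, fun j hj => ?_⟩
    rcases Finset.mem_insert.1 hj with rfl | hj
    · refine ((hc i hi).mono hm).trans (SimpleGraph.Adj.reachable ?_)
      exact ⟨hxi.symm, Finset.mem_insert_of_mem hi, Finset.mem_insert_self _ _⟩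
    · exact (hc j hj).mono hm
  · intro a ha
    rcases Finset.mem_union.1 ha with ha | ha
    · obtain ⟨i, hi, hai⟩ := h.dom a (Finset.mem_of_mem_erase ha)
      exact ⟨i, Finset.mem_insert_of_mem hi, hai⟩
    · exact ⟨x, Finset.mem_insert_self _ _, (mem_E.1 ha).1.symm⟩
  · intro i hi v hv
    rw [expand_union hx]
    rcases Finset.mem_insert.1 hi with rfl | hi
    · by_cases hvS : v ∈ I ∪ A
      · exact Finset.mem_union_left _ hvS
      · exact Finset.mem_union_right _ (mem_E.2 ⟨hv, hvS⟩)
    · exact Finset.mem_union_left _ (h.closed i hi v hv)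

lemma expand_card {I A : Finset V} {x : V} (hx : x ∈ A) :
    (A.erase x ∪ E G I A x).card + 1 = A.card + (E G I A x).card := by
  rw [Finset.card_union_of_disjoint, ← Finset.card_erase_add_one hx]
  · ring
  · rw [Finset.disjoint_left]
    intro v hv hv'
    exact (mem_E.1 hv').2 (Finset.mem_union_right _ (Finset.mem_of_mem_erase hv))

lemma expand_B {I A : Finset V} {x : V} (hx : x ∈ A) :
    (B G ∩ (insert x I ∪ (A.erase x ∪ E G I A x))).card
      = (B G ∩ (I ∪ A)).card + (B G ∩ E G I A x).card := by
  rw [expand_union hx, Finset.inter_union_distrib_left, Finset.card_union_of_disjoint]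
  rw [Finset.disjoint_left]
  intro v hv hv'
  exact (mem_E.1 (Finset.mem_inter.1 hv').2).2 (Finset.mem_inter.1 hv).2

lemma expand_D {I A : Finset V} {x : V} (hx : x ∈ A) (hE : (E G I A x).Nonempty) :
    D G I A ⊆ D G (insert x I) (A.erase x ∪ E G I A x) := by
  intro a ha
  simp only [D, Finset.mem_filter] at ha ⊢
  rw [expand_union hx]
  refine ⟨?_, fun v hv => Finset.mem_union_left _ (ha.2 v hv)⟩
  refine Finset.mem_union_left _ (Finset.mem_erase.2 ⟨?_, ha.1⟩)
  rintro rfl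
  obtain ⟨v, hv⟩ := hE
  exact (mem_E.1 hv).2 (ha.2 v (mem_E.1 hv).1)

lemma D_univ {I A : Finset V} (h : I ∪ A = Finset.univ) : D G I A = A := by
  simp [D, h]

lemma P_final {I A : Finset V} (hg : Good G I A) (h : I ∪ A = Finset.univ) : P G I A 0 := by
  refine ⟨I, A, hg, h, subset_rfl, ?_⟩
  simp only [Phi, D_univ h, h, Finset.inter_univ]
  omega

lemma P_trans {I A I' A' : Finset V} {g g' : ℤ} (hI : I ⊆ I') (h : P G I' A' g')
    (hle : Phi G I A + g ≤ Phi G I' A' + g') : P G I A g := by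
  obtain ⟨I2, A2, h1, h2, h3, h4⟩ := h
  exact ⟨I2, A2, h1, h2, hI.trans h3, by linarith⟩

/-- induction hypothesis -/
def IH (G : SimpleGraph V) [DecidableRel G.Adj] (k : ℕ) (c : ℕ) : Prop :=
  ∀ I A : Finset V, Good G I A → (I ∪ A)ᶜ.card < k → I ∪ A ≠ Finset.univ →
    (∀ v, v ∉ I ∪ A → c ≤ G.degree v) → P G I A c

lemma expand_lt {I A : Finset V} {x : V} (hx : x ∈ A) (hE : (E G I A x).Nonempty) :
    (insert x I ∪ (A.erase x ∪ E G I A x))ᶜ.card < (I ∪ A)ᶜ.card := by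
  apply Finset.card_lt_card
  rw [Finset.compl_ssubset_compl, expand_union hx]
  obtain ⟨v, hv⟩ := hE
  refine ⟨Finset.subset_union_left, fun h => (mem_E.1 hv).2 (h (Finset.mem_union_right _ hv))⟩

lemma big_step {k c : ℕ} (hc : c ≤ 2) (ih : IH G k c) {I A : Finset V} {x : V}
    (h : Good G I A) (hk : (I ∪ A)ᶜ.card ≤ k)
    (hdeg : ∀ v, v ∉ I ∪ A → c ≤ G.degree v) (hx : x ∈ A)
    (hE : 2 ≤ (E G I A x).card) : P G I A (1 + c) := by
  have hne : (E G I A x).Nonempty := Finset.card_pos.1 (by omega)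
  have h1 := expand_card (G := G) (I := I) hx
  have h2 := expand_B (G := G) (I := I) hx
  have h3 := expand_D hx hne
  have h4 := expand_good h hx
  have h5 := expand_lt hx hne
  have h6 : (B G ∩ E G I A x).card ≤ (E G I A x).card :=
    Finset.card_le_card Finset.inter_subset_right
  have h3' := Finset.card_le_card h3
  by_cases hu : insert x I ∪ (A.erase x ∪ E G I A x) = Finset.univ
  · refine P_trans (Finset.subset_insert x I) (P_final h4 hu) ?_
    have h7 : (D G I A).card + (E G I A x).card ≤
        (D G (insert x I) (A.erase x ∪ E G I A x)).card := by
      rw [← Finset.card_union_of_disjoint]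
      · apply Finset.card_le_card
        apply Finset.union_subset h3
        rw [D_univ hu]
        exact Finset.subset_union_right
      · rw [Finset.disjoint_left]
        intro v hv hv'
        exact (mem_E.1 hv').2 (Finset.mem_union_right _ (Finset.mem_filter.1 hv).1)
    simp only [Phi]
    omega
  · refine P_trans (Finset.subset_insert x I) (ih _ _ h4 (by omega) hu ?_) ?_
    · intro v hv
      apply hdeg
      intro hv'
      apply hv
      rw [expand_union hx]
      exact Finset.mem_union_left _ hv'
    · simp only [Phi]
      omega

lemma exists_ext (hconn : G.Connected) {I A : Finset V} (h : Good G I A)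
    (hne : I ∪ A ≠ Finset.univ) : ∃ x ∈ A, (E G I A x).Nonempty := by
  by_contra! hcon
  apply hne
  obtain ⟨r, hr, -⟩ := h.conn
  have key : ∀ v, G.Reachable r v → v ∈ I ∪ A := by
    rintro v ⟨w⟩
    have : ∀ (a b : V) (w : G.Walk a b), a ∈ I ∪ A → b ∈ I ∪ A := by
      intro a b w
      induction w with
      | nil => exact id
      | cons hadj _ ihw =>
        intro ha
        apply ihw
        rcases Finset.mem_union.1 ha with ha | ha
        · exact h.closed _ ha _ hadj
        · by_contra hb
          have := hcon _ ha
          exact Finset.notMem_empty _ (this ▸ mem_E.2 ⟨hadj, hb⟩)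
    exact this _ _ w (Finset.mem_union_left _ hr)
  ext v
  simp only [Finset.mem_univ, iff_true]
  exact key v (hconn.preconnected r v)

lemma step_s9 {k c : ℕ} (hconn : G.Connected) (hc : c ≤ 2) (ih : IH G k c) {I A : Finset V}
    (h : Good G I A) (hk : (I ∪ A)ᶜ.card ≤ k) (hnu : I ∪ A ≠ Finset.univ)
    (hdeg : ∀ v, v ∉ I ∪ A → c ≤ G.degree v) : P G I A c := by
  by_cases hbig : ∃ x ∈ A, 2 ≤ (E G I A x).card
  · obtain ⟨x, hx, hE⟩ := hbig
    exact P_trans subset_rfl (big_step hc ih h hk hdeg hx hE) (by omega)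
  push Not at hbig
  obtain ⟨x, hx, hne⟩ := exists_ext hconn h hnu
  have hE1 : (E G I A x).card = 1 := by
    have := hbig x hx
    have := Finset.card_pos.2 hne
    omega
  obtain ⟨y, hy⟩ := Finset.card_eq_one.1 hE1
  have hyE : y ∈ E G I A x := by simp [hy]
  obtain ⟨hxy, hyS⟩ := mem_E.1 hyE
  have h1 := expand_card (G := G) (I := I) hx
  have h2 := expand_B (G := G) (I := I) hx
  have h3 := expand_D hx hne
  have h4 := expand_good h hx
  have h5 := expand_lt hx hne
  have h3' := Finset.card_le_card h3
  have hU := expand_union (G := G) (I := I) hx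
  have hdeg' : ∀ v, v ∉ insert x I ∪ (A.erase x ∪ E G I A x) → c ≤ G.degree v := by
    intro v hv
    apply hdeg
    intro hv'
    apply hv
    rw [hU]
    exact Finset.mem_union_left _ hv'
  set I1 := insert x I with hI1
  set A1 := A.erase x ∪ E G I A x with hA1
  have hsubI : I ⊆ I1 := Finset.subset_insert x I
  have hyA1 : y ∈ A1 := Finset.mem_union_right _ hyE
  have hyB : (B G ∩ E G I A x).card = if 3 ≤ G.degree y then 1 else 0 := by
    rw [hy]
    split_ifs with hh
    · rw [Finset.inter_singleton_of_mem (by simp [B, hh])]; simp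
    · rw [Finset.inter_singleton_of_notMem (by simpa [B] using hh)]; simp
  -- tree neighbours of y other than x
  set Y := (G.neighborFinset y ∩ (I ∪ A)).erase x with hY
  have hxN : x ∈ G.neighborFinset y ∩ (I ∪ A) := by
    simp [hxy.symm, hx]
  have hYA : ∀ z ∈ Y, z ∈ A ∧ z ≠ x ∧ G.Adj y z := by
    intro z hz
    simp only [hY, Finset.mem_erase, Finset.mem_inter, SimpleGraph.mem_neighborFinset] at hz
    refine ⟨?_, hz.1, hz.2.1⟩
    rcases Finset.mem_union.1 hz.2.2 with hI | hA
    · exact absurd (h.closed z hI y hz.2.1.symm) hyS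
    · exact hA
  have hYD : Y ⊆ D G I1 A1 := by
    intro z hz
    obtain ⟨hzA, hzx, hyz⟩ := hYA z hz
    refine Finset.mem_filter.2 ⟨Finset.mem_union_left _ (Finset.mem_erase.2 ⟨hzx, hzA⟩), ?_⟩
    intro v hv
    rw [hU]
    by_cases hvS : v ∈ I ∪ A
    · exact Finset.mem_union_left _ hvS
    · have hyz' : y ∈ E G I A z := mem_E.2 ⟨hyz.symm, hyS⟩
      have hvz : v ∈ E G I A z := mem_E.2 ⟨hv, hvS⟩
      have := Finset.card_le_one.1 (Nat.lt_succ_iff.1 (hbig z hzA)) v hvz y hyz'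
      rw [this]
      exact Finset.mem_union_right _ hyE
  have hdisj : Disjoint (D G I A) Y := by
    rw [Finset.disjoint_left]
    intro z hz hz'
    exact hyS ((Finset.mem_filter.1 hz).2 y (hYA z hz').2.2.symm)
  have hYcard : Y.card + 1 = (G.neighborFinset y ∩ (I ∪ A)).card :=
    Finset.card_erase_add_one hxN
  have hsum : (D G I A).card + Y.card ≤ (D G I1 A1).card := by
    rw [← Finset.card_union_of_disjoint hdisj]
    exact Finset.card_le_card (Finset.union_subset h3 hYD)
  have hdy : G.degree y = (G.neighborFinset y).card := (G.card_neighborFinset_eq_degree y).symm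
  by_cases hu : I1 ∪ A1 = Finset.univ
  · refine P_trans hsubI (P_final h4 hu) ?_
    have hNS : G.neighborFinset y ∩ (I ∪ A) = G.neighborFinset y := by
      rw [Finset.inter_eq_left]
      intro v hv
      have hvu : v ∈ I1 ∪ A1 := by rw [hu]; exact Finset.mem_univ _
      rw [hU, hy] at hvu
      rcases Finset.mem_union.1 hvu with h' | h'
      · exact h'
      · rw [Finset.mem_singleton.1 h'] at hv
        simp at hv
    have hyY : y ∉ D G I A ∪ Y := by
      intro hh
      rcases Finset.mem_union.1 hh with hh | hh
      · exact hyS (Finset.mem_union_right _ (Finset.mem_filter.1 hh).1)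
      · exact hyS (Finset.mem_union_right _ (hYA y hh).1)
    have hsum' : (D G I A).card + Y.card + 1 ≤ (D G I1 A1).card := by
      rw [← Finset.card_union_of_disjoint hdisj, ← Finset.card_insert_of_notMem hyY]
      apply Finset.card_le_card
      apply Finset.insert_subset _ (Finset.union_subset h3 hYD)
      rw [D_univ hu]; exact hyA1
    have hcy := hdeg y hyS
    rw [hNS, ← hdy] at hYcard
    simp only [Phi]
    split_ifs at hyB <;> omega
  · by_cases hcase : 3 ≤ G.degree y ∧ Y.card = 0
    · have hE2 : 2 ≤ (E G I1 A1 y).card := by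
        have hsub : G.neighborFinset y ⊆ insert x (E G I1 A1 y) := by
          intro v hv
          rw [SimpleGraph.mem_neighborFinset] at hv
          by_cases hvx : v = x
          · simp [hvx]
          refine Finset.mem_insert_of_mem (mem_E.2 ⟨hv, ?_⟩)
          rw [hU, hy]
          intro hh
          rcases Finset.mem_union.1 hh with hh | hh
          · have : v ∈ Y := by simp [hY, hvx, hv, Finset.mem_union.1 hh]
            rw [Finset.card_eq_zero.1 hcase.2] at this
            simp at this
          · rw [Finset.mem_singleton.1 hh] at hv
            exact G.loopless.irrefl _ hv
        have := Finset.card_le_card hsub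
        have := Finset.card_insert_le x (E G I1 A1 y)
        omega
      refine P_trans hsubI
        (big_step hc ih h4 (by omega) hdeg' hyA1 hE2) ?_
      simp only [Phi]
      split_ifs at hyB <;> omega
    · refine P_trans hsubI (ih _ _ h4 (by omega) hu hdeg') ?_
      simp only [Phi]
      split_ifs at hyB <;> omega

lemma loop {c : ℕ} (hconn : G.Connected) (hc : c ≤ 2) (k : ℕ) : IH G k c := by
  induction k with
  | zero => intro I A _ h; omega
  | succ k ih =>
    intro I A h hk hnu hdeg
    exact step_s9 hconn hc ih h (by omega) hnu hdeg

lemma run {c : ℕ} (hconn : G.Connected) (hc : c ≤ 2) {I A : Finset V} (h : Good G I A)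
    (hnu : I ∪ A ≠ Finset.univ) (hdeg : ∀ v, c ≤ G.degree v) : P G I A c :=
  loop hconn hc _ I A h (Nat.lt_succ_self _) hnu (fun v _ => hdeg v)

/-- final tree -/
lemma final_tree [Nontrivial V] {I A : Finset V} (h : Good G I A) (hu : I ∪ A = Finset.univ) :
    ∃ T : SimpleGraph V, T ≤ G ∧ T.Connected ∧ T.IsAcyclic ∧
      ∀ v, (v ∈ A ∨ G.degree v = 1) → (T.neighborSet v).ncard = 1 := by
  have hdis := Finset.disjoint_left.1 h.disj
  choose! p hpI hpA using h.dom
  let H : SimpleGraph V :=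
    { Adj := fun u v => G.Adj u v ∧ ((u ∈ I ∧ v ∈ I) ∨ (u ∈ A ∧ p u = v) ∨ (v ∈ A ∧ p v = u))
      symm := ⟨fun u v k => ⟨k.1.symm, by tauto⟩⟩
      loopless := ⟨fun _ k => G.loopless.irrefl _ k.1⟩ }
  have hHG : H ≤ G := fun _ _ k => k.1
  obtain ⟨r, hr, hc⟩ := h.conn
  have hRH : R G I ≤ H := fun _ _ k => ⟨k.1, Or.inl k.2⟩
  have hreach : ∀ v, H.Reachable r v := by
    intro v
    have hv : v ∈ I ∪ A := by rw [hu]; exact Finset.mem_univ _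
    rcases Finset.mem_union.1 hv with hv | hv
    · exact (hc v hv).mono hRH
    · refine ((hc _ (hpI v hv)).mono hRH).trans (SimpleGraph.Adj.reachable ?_)
      exact ⟨(hpA v hv).symm, Or.inr (Or.inr ⟨hv, rfl⟩)⟩
  have hHc : H.Connected := by
    haveI : Nonempty V := ⟨r⟩
    exact ⟨fun u v => (hreach u).symm.trans (hreach v)⟩
  obtain ⟨T, hT, hTt⟩ := hHc.exists_isTree_le
  refine ⟨T, hT.trans hHG, hTt.1, hTt.2, ?_⟩
  intro v hv
  have hne : (T.neighborSet v).Nonempty := by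
    obtain ⟨w, hw⟩ := hTt.1.preconnected.exists_adj_of_nontrivial v
    exact ⟨w, hw⟩
  obtain ⟨q, hq⟩ : ∃ q, T.neighborSet v ⊆ {q} := by
    rcases hv with hv | hv
    · refine ⟨p v, fun w hw => ?_⟩
      have hw' : H.Adj v w := hT hw
      rcases hw'.2 with k | k | k
      · exact absurd hv (hdis k.1)
      · exact k.2.symm
      · exact absurd hv (hdis (k.2 ▸ hpI w k.1))
    · rw [← SimpleGraph.card_neighborFinset_eq_degree] at hv
      obtain ⟨q, hq⟩ := Finset.card_eq_one.1 hv
      refine ⟨q, fun w hw => ?_⟩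
      have : w ∈ G.neighborFinset v := by
        rw [SimpleGraph.mem_neighborFinset]; exact hHG (hT hw)
      rw [hq] at this
      simpa using this
  rw [hne.subset_singleton_iff.1 hq, Set.ncard_singleton]

lemma star_good (v : V) : Good G {v} (G.neighborFinset v) := by
  refine ⟨by simp, ⟨v, by simp, by simp⟩, ?_, ?_⟩
  · intro a ha
    exact ⟨v, by simp, by simpa [SimpleGraph.adj_comm] using ha⟩
  · intro i hi w hw
    rw [Finset.mem_singleton.1 hi] at hw
    simp [hw]

lemma core (hconn : G.Connected) [Nontrivial V] (hB : 1 ≤ (B G).card) :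
    ∃ T : SimpleGraph V, T ≤ G ∧ T.Connected ∧ T.IsAcyclic ∧
      (B G).card + 8 ≤ 4 * {v : V | (T.neighborSet v).ncard = 1}.ncard := by
  have hdeg1 : ∀ v, 1 ≤ G.degree v := fun v => by
    obtain ⟨w, hw⟩ := hconn.preconnected.exists_adj_of_nontrivial v
    exact (G.degree_pos_iff_exists_adj v).2 ⟨w, hw⟩
  -- reduction
  have main : ∀ I A : Finset V, Good G I A → I ∪ A = Finset.univ → ∀ Q : Finset V,
      (∀ v ∈ Q, v ∈ A ∨ G.degree v = 1) → (B G).card + 8 ≤ 4 * Q.card →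
      ∃ T : SimpleGraph V, T ≤ G ∧ T.Connected ∧ T.IsAcyclic ∧
      (B G).card + 8 ≤ 4 * {v : V | (T.neighborSet v).ncard = 1}.ncard := by
    intro I A hg hu Q hQ hcard
    obtain ⟨T, h1, h2, h3, h4⟩ := final_tree hg hu
    refine ⟨T, h1, h2, h3, hcard.trans ?_⟩
    have : Q.card ≤ {v : V | (T.neighborSet v).ncard = 1}.ncard := by
      rw [← Set.ncard_coe_finset]
      exact Set.ncard_le_ncard (fun v hv => h4 v (hQ v hv)) (Set.toFinite _)
    omega
  -- star start
  have star : ∀ v, 3 ≤ G.degree v → ∀ c ≤ 2, (∀ u, c ≤ G.degree u) →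
      (B G ∩ ({v} ∪ G.neighborFinset v)).card + 8 ≤
        3 * G.degree v + (D G {v} (G.neighborFinset v)).card + c ∨
      (B G ∩ ({v} ∪ G.neighborFinset v)).card + 7 ≤
        3 * G.degree v + (D G {v} (G.neighborFinset v)).card + c ∧ Even (B G).card →
      ∃ T : SimpleGraph V, T ≤ G ∧ T.Connected ∧ T.IsAcyclic ∧
      (B G).card + 8 ≤ 4 * {v : V | (T.neighborSet v).ncard = 1}.ncard := by
    intro v hv c hc hcd hphi
    have hg := star_good (G := G) v
    have hdv := G.card_neighborFinset_eq_degree v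
    by_cases hu : {v} ∪ G.neighborFinset v = Finset.univ
    · refine main _ _ hg hu _ (fun v hv => Or.inl hv) ?_
      have h1 : (B G).card ≤ ({v} ∪ G.neighborFinset v).card := by
        rw [hu]; exact Finset.card_le_card (Finset.subset_univ _)
      have h2 := Finset.card_union_le {v} (G.neighborFinset v)
      rw [Finset.card_singleton] at h2
      omega
    · obtain ⟨I', A', h1, h2, h3, h4⟩ := run hconn hc hg hu hcd
      refine main _ _ h1 h2 A' (fun v hv => Or.inl hv) ?_
      simp only [Phi] at h4
      rcases hphi with hphi | ⟨hphi, e, he⟩ <;> omega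
  have hstarB : ∀ v, (B G ∩ ({v} ∪ G.neighborFinset v)).card ≤ G.degree v + 1 := by
    intro v
    have h2 := Finset.card_union_le {v} (G.neighborFinset v)
    rw [Finset.card_singleton, G.card_neighborFinset_eq_degree v] at h2
    have := Finset.card_le_card
      (Finset.inter_subset_right (s₁ := B G) (s₂ := {v} ∪ G.neighborFinset v))
    omega
  by_cases hp : ∃ y, G.degree y = 1
  · obtain ⟨y, hy⟩ := hp
    have hy' := hy
    rw [← SimpleGraph.card_neighborFinset_eq_degree] at hy'
    obtain ⟨w, hw⟩ := Finset.card_eq_one.1 hy'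
    have hyw : G.Adj y w := by
      rw [← SimpleGraph.mem_neighborFinset, hw]; simp
    have hyB : y ∉ B G := by simp [B, hy]
    by_cases hw3 : 3 ≤ G.degree w
    · refine star w hw3 1 (by omega) hdeg1 (Or.inl ?_)
      have hyS : y ∈ {w} ∪ G.neighborFinset w := by simp [hyw.symm]
      have h1 : (B G ∩ ({w} ∪ G.neighborFinset w)).card ≤ G.degree w := by
        have : B G ∩ ({w} ∪ G.neighborFinset w) ⊆ ({w} ∪ G.neighborFinset w).erase y := by
          intro z hz
          rw [Finset.mem_inter] at hz
          exact Finset.mem_erase.2 ⟨fun e => hyB (e ▸ hz.1), hz.2⟩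
        have h3 := Finset.card_le_card this
        have h4 := Finset.card_erase_add_one hyS
        have h2 := Finset.card_union_le {w} (G.neighborFinset w)
        rw [Finset.card_singleton, G.card_neighborFinset_eq_degree w] at h2
        omega
      have h2 : 1 ≤ (D G {w} (G.neighborFinset w)).card := by
        apply Finset.card_pos.2
        refine ⟨y, Finset.mem_filter.2 ⟨by simp [hyw.symm], fun v hv => ?_⟩⟩
        rw [← SimpleGraph.mem_neighborFinset, hw] at hv
        exact Finset.mem_union_left _ hv
      omega
    · have hg := star_good (G := G) y
      have hwB : w ∉ B G := by simpa [B] using hw3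
      have hempty : B G ∩ ({y} ∪ G.neighborFinset y) = ∅ := by
        rw [hw]
        ext z
        simp only [Finset.mem_inter, Finset.mem_union, Finset.mem_singleton,
          Finset.notMem_empty, iff_false]
        rintro ⟨hz, rfl | rfl⟩
        · exact hyB hz
        · exact hwB hz
      have hu : {y} ∪ G.neighborFinset y ≠ Finset.univ := by
        intro hu
        rw [hu, Finset.inter_univ] at hempty
        rw [hempty] at hB
        simp at hB
      obtain ⟨I', A', h1, h2, h3, h4⟩ := run (c := 1) hconn (by omega) hg hu hdeg1
      have hyA : y ∉ A' := Finset.disjoint_left.1 h1.disj (h3 (by simp))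
      refine main _ _ h1 h2 (insert y A') ?_ ?_
      · intro v hv
        rcases Finset.mem_insert.1 hv with rfl | hv
        · exact Or.inr hy
        · exact Or.inl hv
      · rw [Finset.card_insert_of_notMem hyA]
        simp only [Phi] at h4
        rw [hempty, hy', Finset.card_empty] at h4
        omega
  · push Not at hp
    have hdeg2 : ∀ v, 2 ≤ G.degree v := fun v => by
      have := hp v
      have := hdeg1 v
      omega
    by_cases h4 : ∃ v, 4 ≤ G.degree v
    · obtain ⟨v, hv⟩ := h4
      refine star v (by omega) 2 le_rfl hdeg2 (Or.inl ?_)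
      have := hstarB v
      omega
    · push Not at h4
      obtain ⟨v, hv⟩ := Finset.card_pos.1 hB
      have hv3 : 3 ≤ G.degree v := (Finset.mem_filter.1 hv).2
      refine star v hv3 2 le_rfl hdeg2 (Or.inr ⟨?_, ?_⟩)
      · have := hstarB v
        omega
      · have := G.even_card_odd_degree_vertices
        convert this using 2
        unfold B
        ext u
        simp only [Finset.mem_filter, Finset.mem_univ, true_and]
        have a := h4 u
        have b := hdeg2 u
        rw [Nat.odd_iff]
        omega

end KW

/-- Corollary to Kleitman–West: a connected finite simple graph with at least `n ≥ 1`
vertices of degree at least 3 has a spanning tree with at least `n/4 + 2` leaves. -/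
theorem kleitman_west_cor {V : Type*} [Fintype V] (G : SimpleGraph V) [DecidableRel G.Adj]
    (hconn : G.Connected) (n : ℕ) (hn : 1 ≤ n)
    (hdeg : n ≤ {v : V | 3 ≤ G.degree v}.ncard) :
    ∃ T : SimpleGraph V, T ≤ G ∧ T.Connected ∧ T.IsAcyclic ∧
      (n : ℝ) / 4 + 2 ≤ ({v : V | (T.neighborSet v).ncard = 1}.ncard : ℝ) := by
  classical
  have hB : {v : V | 3 ≤ G.degree v}.ncard = (KW.B G).card := by
    rw [← Set.ncard_coe_finset]
    simp [KW.B]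
  rw [hB] at hdeg
  obtain ⟨v, hv⟩ := Finset.card_pos.1 (lt_of_lt_of_le hn hdeg)
  have hv3 : 3 ≤ G.degree v := (Finset.mem_filter.1 hv).2
  obtain ⟨w, hw⟩ := (G.degree_pos_iff_exists_adj v).1 (by omega)
  haveI : Nontrivial V := ⟨v, w, hw.ne⟩
  obtain ⟨T, h1, h2, h3, h4⟩ := KW.core hconn (hn.trans hdeg)
  refine ⟨T, h1, h2, h3, ?_⟩
  have h5 : n + 8 ≤ 4 * {v : V | (T.neighborSet v).ncard = 1}.ncard := by omega
  have h6 : (n : ℝ) + 8 ≤ 4 * ({v : V | (T.neighborSet v).ncard = 1}.ncard : ℝ) := by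
    exact_mod_cast h5
  linarith
end

section
/- Directed-graph selection lemma: Let G be a finite directed graph in which every vertex v has an incoming arrow from some vertex u ≠ v. Let S be any subset of the vertices of G. Then there is a subset S' ⊆ S with |S'| ≥ |S|/3 such that for every v ∈ S' there is an arrow from some vertex not in S' to v. -/
theorem three_col_aux {V : Type*} [DecidableEq V] (f : V → V) (hf : ∀ v, f v ≠ v) (n : ℕ) :
    ∀ T : Finset V, T.card = n → ∃ c : V → Fin 3, ∀ v ∈ T, f v ∈ T → c v ≠ c (f v) := by
  induction n with
  | zero =>
    intro T hT
    rw [Finset.card_eq_zero] at hT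
    subst hT
    exact ⟨fun _ => 0, by simp⟩
  | succ n ih =>
    intro T hT
    have hne : T.Nonempty := by
      rw [← Finset.card_pos]; omega
    obtain ⟨v, hv, hfib⟩ := Finset.exists_card_fiber_le_of_card_le_mul (s := T) (t := T) (f := f)
      (n := 1) hne (by simp)
    obtain ⟨c, hc⟩ := ih (T.erase v) (by rw [Finset.card_erase_of_mem hv]; omega)
    have hcard : (insert (c (f v)) ((T.filter (fun x => f x = v)).image c)).card < 3 := by
      have h1 := Finset.card_insert_le (c (f v)) ((T.filter (fun x => f x = v)).image c)
      have h2 := Finset.card_image_le (s := T.filter (fun x => f x = v)) (f := c)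
      omega
    obtain ⟨k, hk⟩ : ∃ k : Fin 3, k ∉ insert (c (f v)) ((T.filter (fun x => f x = v)).image c) := by
      by_contra! h
      rw [← Finset.eq_univ_iff_forall] at h
      rw [h] at hcard
      simp at hcard
    simp only [Finset.mem_insert, Finset.mem_image, Finset.mem_filter, not_or, not_exists,
      not_and] at hk
    refine ⟨Function.update c v k, fun x hx hfx => ?_⟩
    by_cases hxv : x = v
    · subst hxv
      rw [Function.update_self, Function.update_of_ne (hf x)]
      exact hk.1
    · rw [Function.update_of_ne hxv]
      by_cases hfv : f x = v
      · rw [hfv, Function.update_self]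
        exact hk.2 x ⟨hx, hfv⟩
      · rw [Function.update_of_ne hfv]
        exact hc x (Finset.mem_erase.2 ⟨hxv, hx⟩) (Finset.mem_erase.2 ⟨hfv, hfx⟩)

/-- Directed-graph selection lemma: if in a finite directed graph every vertex `v` has an
incoming arrow from some vertex `u ≠ v`, then for any subset `S` of the vertices there is
`S' ⊆ S` with `|S'| ≥ |S|/3` such that every `v ∈ S'` receives an arrow from outside `S'`. -/
theorem directed_selection {V : Type*} [Fintype V]
    (E : V → V → Prop) (hin : ∀ v : V, ∃ u : V, u ≠ v ∧ E u v)
    (S : Finset V) :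
    ∃ S' ⊆ S, (S.card : ℝ) / 3 ≤ (S'.card : ℝ) ∧
      ∀ v ∈ S', ∃ u : V, u ∉ S' ∧ E u v := by
  classical
  choose f hf hE using hin
  obtain ⟨c, hc⟩ := three_col_aux f hf S.card S rfl
  obtain ⟨k, hk⟩ : ∃ k : Fin 3, S.card ≤ 3 * (S.filter (fun x => c x = k)).card := by
    have h := Finset.card_eq_sum_card_fiberwise (s := S) (t := Finset.univ) (f := c) (by simp)
    rw [Fin.sum_univ_three] at h
    by_contra! h'
    have h0 := h' 0
    have h1 := h' 1
    have h2 := h' 2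
    omega
  refine ⟨S.filter (fun x => c x = k), Finset.filter_subset _ _, ?_, fun v hv => ⟨f v, ?_, hE v⟩⟩
  · have : (S.card : ℝ) ≤ 3 * ((S.filter (fun x => c x = k)).card : ℝ) := by exact_mod_cast hk
    linarith
  · intro h
    rw [Finset.mem_filter] at hv h
    exact hc v hv.1 h.1 (hv.2.trans h.2.symm)
end

section
/- Writer–reader counting bound: Let k ≥ 1, let 𝐧 be a nonempty subset of {1, 2, …, 2k}, and let κ ≥ 1, ν ≥ 0 be integers. For an equivalence relation ∼ on 𝐧, let G_∼ be the simple graph whose vertices are the equivalence classes of ∼, with an edge between two distinct classes c, c' whenever some element of one class is the immediate successor, in the increasing enumeration of 𝐧, of some element of the other class. Then the number of equivalence relations ∼ on 𝐧 such that (i) at most ν equivalence classes have degree ≥ 3 in G_∼, and (ii) every equivalence class c contains at most κ elements i whose immediate successor in 𝐧 exists and lies outside c, is at most 5^{|𝐧|} · (2k)^{(κ−1)ν + 2}. -/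
/-- `IsSuccIn nset i j` : `j` is the immediate successor of `i` in the finite set
`nset ⊆ ℕ`, i.e. the smallest element of `nset` strictly greater than `i`. -/
def IsSuccIn (nset : Finset ℕ) (i j : ℕ) : Prop :=
  j ∈ nset ∧ i < j ∧ ∀ m ∈ nset, i < m → j ≤ m

open Classical in
/-- final neighbours of `v` in the walk `f 0, …, f m` -/
noncomputable def wrN (f : ℕ → ℕ) (m v : ℕ) : Finset ℕ :=
  ((Finset.range (m+1)).image f).filter (fun w => w ≠ v ∧ ∃ s < m,
    (f s = v ∧ f (s+1) = w) ∨ (f s = w ∧ f (s+1) = v))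

/-- neighbours of `f t` seen up to time `t` -/
def wrS (f : ℕ → ℕ) (t : ℕ) : Set ℕ :=
  {w | w ≠ f t ∧ ∃ s < t, (f s = f t ∧ f (s+1) = w) ∨ (f s = w ∧ f (s+1) = f t)}

theorem wr_pick : ∃ A B : Set ℕ → ℕ, ∀ S : Set ℕ, (∃ a b, S ⊆ {a, b}) → S ⊆ {A S, B S} := by
  have : ∀ S : Set ℕ, ∃ a b, (∃ a b, S ⊆ {a, b}) → S ⊆ {a, b} := by
    intro S
    by_cases h : ∃ a b, S ⊆ {a, b}
    · obtain ⟨a, b, hab⟩ := h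
      exact ⟨a, b, fun _ => hab⟩
    · exact ⟨0, 0, fun h' => absurd h' h⟩
  choose A B h using this
  exact ⟨A, B, h⟩

theorem wr_two (N : Finset ℕ) (h : N.card ≤ 2) : ∃ a b, (N : Set ℕ) ⊆ {a, b} := by
  have : N.card = 0 ∨ N.card = 1 ∨ N.card = 2 := by omega
  rcases this with h | h | h
  · rw [Finset.card_eq_zero] at h
    exact ⟨0, 0, by simp [h]⟩
  · rw [Finset.card_eq_one] at h
    obtain ⟨a, rfl⟩ := h
    exact ⟨a, a, by simp⟩
  · rw [Finset.card_eq_two] at h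
    obtain ⟨a, b, _, rfl⟩ := h
    exact ⟨a, b, by simp⟩

open Classical in
/-- step code -/
noncomputable def wrC (A B : Set ℕ → ℕ) (f : ℕ → ℕ) (t : ℕ) : Fin 5 :=
  if f (t+1) = f t then 0 else if f (t+1) = t+1 then 1 else
    if f (t+1) = A (wrS f t) then 2 else if f (t+1) = B (wrS f t) then 3 else 4

theorem wrS_congr (f g : ℕ → ℕ) (t : ℕ) (h : ∀ s ≤ t, f s = g s) : wrS f t = wrS g t := by
  ext w
  simp only [wrS, Set.mem_ofPred_eq]
  rw [h t le_rfl]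
  refine and_congr Iff.rfl (exists_congr fun s => and_congr_right fun hs => ?_)
  rw [h s (by omega), h (s+1) (by omega)]

theorem wr_decode (A B : Set ℕ → ℕ) (f g : ℕ → ℕ) (m : ℕ) (h0 : f 0 = g 0)
    (hc : ∀ t < m, wrC A B f t = wrC A B g t)
    (hp : ∀ t < m, wrC A B f t = 4 → f (t+1) = g (t+1)) : ∀ t ≤ m, f t = g t := by
  intro t
  induction t using Nat.strong_induction_on with
  | _ t ih =>
    intro ht
    rcases t with _ | t
    · exact h0
    have hS := wrS_congr f g t (fun s hs => ih s (by omega) (by omega))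
    have hft := ih t (by omega) (by omega)
    have h1 := hc t (by omega)
    have h2 := hp t (by omega)
    by_cases h4 : wrC A B f t = 4
    · exact h2 h4
    have h4' := h1 ▸ h4
    unfold wrC at h1 h4 h4'
    rw [hS, hft] at h1 h4
    split_ifs at h1 h4 h4' <;> simp_all

theorem wr_cost (A B : Set ℕ → ℕ) (hAB : ∀ S : Set ℕ, (∃ a b, S ⊆ {a, b}) → S ⊆ {A S, B S})
    (f : ℕ → ℕ) (m κ ν : ℕ) (hκ : 1 ≤ κ) (hle : ∀ t ≤ m, f t ≤ t)
    (hff : ∀ t ≤ m, f (f t) = f t)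
    (hhub : (((Finset.range (m+1)).image f).filter (fun v => 3 ≤ (wrN f m v).card)).card ≤ ν)
    (hdep : ∀ v, ((Finset.range m).filter (fun t => f t = v ∧ f (t+1) ≠ v)).card ≤ κ) :
    ((Finset.range m).filter (fun t => wrC A B f t = 4)).card ≤ (κ - 1) * ν + 2 := by
  classical
  set V := (Finset.range (m+1)).image f with hV
  set New : ℕ → Prop := fun t => ∀ s < t, s(f s, f (s+1)) ≠ s(f t, f (t+1)) with hNew
  set hub : ℕ → Prop := fun v => 3 ≤ (wrN f m v).card with hhubdef
  set Q := (Finset.range m).filter (fun t => f t ≠ f (t+1) ∧ (New t ∨ hub (f t))) with hQ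
  set Sp := (Finset.range m).filter (fun t => wrC A B f t = 4) with hSp
  set Fr := (Finset.range m).filter (fun t => f (t+1) = t+1) with hFr
  have hmemN : ∀ v w, w ∈ wrN f m v ↔ w ≠ v ∧ ∃ s < m,
      (f s = v ∧ f (s+1) = w) ∨ (f s = w ∧ f (s+1) = v) := by
    intro v w
    simp only [wrN, Finset.mem_filter, and_iff_right_iff_imp, Finset.mem_image, Finset.mem_range]
    rintro ⟨_, s, hs, h | h⟩
    · exact ⟨s+1, by omega, h.2⟩
    · exact ⟨s, by omega, h.1⟩
  have hdisj : Disjoint Sp Fr := by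
    rw [Finset.disjoint_left]
    intro t h1 h2
    have h3 := (Finset.mem_filter.1 h1).2
    have h4 := (Finset.mem_filter.1 h2).2
    unfold wrC at h3
    clear_value Sp Fr
    split_ifs at h3 <;> simp_all
  have hsubQ : Sp ∪ Fr ⊆ Q := by
    intro t ht
    rw [Finset.mem_union] at ht
    rcases ht with ht | ht
    · simp only [hSp, Finset.mem_filter, Finset.mem_range] at ht
      obtain ⟨htm, h4⟩ := ht
      have hx : f (t+1) ≠ f t ∧ f (t+1) ≠ A (wrS f t) ∧ f (t+1) ≠ B (wrS f t) := by
        unfold wrC at h4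
        split_ifs at h4 <;> simp_all
      simp only [hQ, Finset.mem_filter, Finset.mem_range]
      refine ⟨htm, hx.1.symm, ?_⟩
      by_contra hcon
      push Not at hcon
      obtain ⟨hn, hh⟩ := hcon
      simp only [hNew] at hn
      push Not at hn
      obtain ⟨s, hs, hse⟩ := hn
      have hin : f (t+1) ∈ wrS f t := by
        refine ⟨hx.1, s, hs, ?_⟩
        rw [Sym2.eq_iff] at hse
        tauto
      have hsubN : wrS f t ⊆ (wrN f m (f t) : Set ℕ) := by
        rintro w ⟨hw, s, hs, h⟩
        rw [Finset.mem_coe, hmemN]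
        exact ⟨hw, s, by omega, h⟩
      obtain ⟨a, b, hab⟩ := wr_two (wrN f m (f t)) (by simp only [hhubdef] at hh; omega)
      have := hAB _ ⟨a, b, hsubN.trans hab⟩ hin
      rcases this with h | h
      · exact hx.2.1 h
      · exact hx.2.2 h
    · simp only [hFr, Finset.mem_filter, Finset.mem_range] at ht
      simp only [hQ, Finset.mem_filter, Finset.mem_range]
      have h1 := hle t (by omega)
      refine ⟨ht.1, by omega, Or.inl ?_⟩
      intro s hs he
      have h2 := hle s (by omega)
      have h3 := hle (s+1) (by omega)
      rw [Sym2.eq_iff] at he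
      omega
  have hVFr : V.card ≤ Fr.card + 1 := by
    have : V ⊆ insert 0 (Fr.image (· + 1)) := by
      intro v hv
      simp only [hV, Finset.mem_image, Finset.mem_range] at hv
      obtain ⟨t, ht, rfl⟩ := hv
      rw [Finset.mem_insert, Finset.mem_image]
      have h1 := hle t (by omega)
      have h2 := hff t (by omega)
      rcases Nat.eq_zero_or_pos (f t) with h | h
      · exact Or.inl h
      · right
        have h3 : f t - 1 + 1 = f t := by omega
        refine ⟨f t - 1, ?_, h3⟩
        simp only [hFr, Finset.mem_filter, Finset.mem_range]
        rw [h3]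
        exact ⟨by omega, h2⟩
    calc V.card ≤ _ := Finset.card_le_card this
      _ ≤ _ := Finset.card_insert_le _ _
      _ ≤ _ := Nat.add_le_add_right Finset.card_image_le 1
  have hQsum : Q.card = ∑ v ∈ V, (Q.filter (fun t => f t = v)).card := by
    apply Finset.card_eq_sum_card_fiberwise
    intro t ht
    simp only [hQ, Finset.coe_filter, Finset.mem_range, Set.mem_ofPred_eq] at ht
    simp only [hV, Finset.coe_image, Set.mem_image, Finset.mem_coe, Finset.mem_range]
    exact ⟨t, by omega, rfl⟩
  have hcnt : ∀ v ∈ V, (Q.filter (fun t => f t = v)).card ≤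
      (if hub v then κ else 1) + (if v = 0 then 1 else 0) := by
    intro v hv
    by_cases hh : hub v
    · rw [if_pos hh]
      refine le_trans (le_trans (Finset.card_le_card ?_) (hdep v)) (Nat.le_add_right _ _)
      intro t ht
      simp only [hQ, Finset.mem_filter, Finset.mem_range] at ht ⊢
      obtain ⟨⟨h1, h2, _⟩, h3⟩ := ht
      exact ⟨h1, h3, fun h => h2 (h3.trans h.symm)⟩
    · rw [if_neg hh]
      have hinj : ((Q.filter (fun t => f t = v)).image (fun t => f (t+1))).card
          = (Q.filter (fun t => f t = v)).card := by
        apply Finset.card_image_of_injOn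
        have key : ∀ t t', t ∈ Q.filter (fun t => f t = v) → t' ∈ Q.filter (fun t => f t = v) →
            f (t+1) = f (t'+1) → ¬ t < t' := by
          intro t t' ht ht' he hlt
          simp only [hQ, Finset.mem_filter, Finset.mem_range] at ht ht'
          rcases ht'.1.2.2 with h | h
          · apply h t hlt
            rw [he, ht.2, ht'.2]
          · rw [ht'.2] at h; exact hh h
        intro t ht t' ht' he
        rcases lt_trichotomy t t' with h | h | h
        · exact absurd h (key t t' ht ht' he)
        · exact h
        · exact absurd h (key t' t ht' ht he.symm)
      have hsubN : (Q.filter (fun t => f t = v)).image (fun t => f (t+1)) ⊆ wrN f m v := by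
        intro w hw
        simp only [hQ, Finset.mem_image, Finset.mem_filter, Finset.mem_range] at hw
        obtain ⟨t, ⟨⟨h1, h2, _⟩, h3⟩, rfl⟩ := hw
        rw [hmemN]
        exact ⟨fun h => h2 (h3.trans h.symm), t, h1, Or.inl ⟨h3, rfl⟩⟩
      rw [← hinj]
      simp only [hhubdef] at hh
      by_cases hv0 : v = 0
      · rw [if_pos hv0]
        have := Finset.card_le_card hsubN
        omega
      · rw [if_neg hv0]
        simp only [hV, Finset.mem_image, Finset.mem_range] at hv
        obtain ⟨u, hu, huv⟩ := hv
        have hvu := hle u (by omega)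
        have hfv : f v = v := by rw [← huv]; exact hff u (by omega)
        have hv1 : v - 1 + 1 = v := by omega
        have hlt := hle (v-1) (by omega)
        have hmem : f (v-1) ∈ wrN f m v := by
          rw [hmemN]
          exact ⟨by omega, v-1, by omega, Or.inr ⟨rfl, by rw [hv1, hfv]⟩⟩
        have hsub2 : (Q.filter (fun t => f t = v)).image (fun t => f (t+1)) ⊆
            (wrN f m v).erase (f (v-1)) := by
          intro w hw
          rw [Finset.mem_erase]
          refine ⟨?_, hsubN hw⟩
          rintro rfl
          simp only [hQ, Finset.mem_image, Finset.mem_filter, Finset.mem_range] at hw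
          obtain ⟨t, ⟨⟨h1, h2, h3⟩, h4⟩, h5⟩ := hw
          have h6 := hle t (by omega)
          rcases h3 with h3 | h3
          · apply h3 (v-1) (by omega)
            rw [hv1, hfv, h4, h5, Sym2.eq_swap]
          · rw [h4] at h3; exact hh h3
        have h1 := Finset.card_le_card hsub2
        rw [Finset.card_erase_of_mem hmem] at h1
        omega
  have hsum := Finset.sum_le_sum hcnt
  rw [← hQsum, Finset.sum_add_distrib] at hsum
  have hz : ∑ v ∈ V, (if v = 0 then 1 else 0) ≤ 1 := by
    rw [Finset.sum_ite_eq']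
    split_ifs <;> omega
  have hs2 : ∑ v ∈ V, (if hub v then κ else 1) = (V.filter hub).card * (κ - 1) + V.card := by
    obtain ⟨κ', rfl⟩ : ∃ κ', κ = κ' + 1 := ⟨κ - 1, by omega⟩
    have : ∀ v ∈ V, (if hub v then κ'+1 else 1) = (if hub v then κ' else 0) + 1 := by
      intro v _; split_ifs <;> omega
    rw [Finset.sum_congr rfl this, Finset.sum_add_distrib, ← Finset.sum_filter]
    simp
  have h1 := Finset.card_le_card hsubQ
  rw [Finset.card_union_of_disjoint hdisj] at h1
  have h2 : (V.filter hub).card * (κ - 1) ≤ (κ - 1) * ν := by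
    rw [mul_comm]
    refine Nat.mul_le_mul_left _ (le_trans (le_of_eq ?_) hhub)
    congr
  omega

theorem wr_count {α : Type*} (S : Finset α) (F : α → ℕ → ℕ) (A B : Set ℕ → ℕ) (m K C : ℕ)
    (hK : m < K)
    (hF0 : ∀ a ∈ S, ∀ t ≤ m, F a t ≤ t)
    (hinj : ∀ a ∈ S, ∀ b ∈ S, (∀ t ≤ m, F a t = F b t) → a = b)
    (hcost : ∀ a ∈ S, ((Finset.range m).filter (fun t => wrC A B (F a) t = 4)).card ≤ C) :
    S.card ≤ 5 ^ m * K ^ C := by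
  classical
  let σ : α → (Fin m → Fin 5) := fun a t => wrC A B (F a) t
  have key : ∀ w ∈ S.image σ, (S.filter (fun a => σ a = w)).card ≤ K ^ C := by
    intro w hw
    rw [Finset.mem_image] at hw
    obtain ⟨a, ha, rfl⟩ := hw
    set T := (Finset.range m).filter (fun t => wrC A B (F a) t = 4) with hT
    have hcard : (Finset.univ : Finset (T → Fin K)).card = K ^ T.card := by simp
    have : (S.filter (fun b => σ b = σ a)).card ≤ (Finset.univ : Finset (T → Fin K)).card := by
      apply Finset.card_le_card_of_injOn
        (fun b => fun t : T => (⟨F b (t+1) % K, Nat.mod_lt _ (by omega)⟩ : Fin K))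
      · intro b _; simp
      · intro b hb c hc hbc
        simp only [Finset.coe_filter, Set.mem_ofPred_eq] at hb hc
        apply hinj b hb.1 c hc.1
        have hcode : ∀ d, σ d = σ a → ∀ t < m, wrC A B (F d) t = wrC A B (F a) t := by
          intro d hd t ht
          exact congrFun hd ⟨t, ht⟩
        apply wr_decode A B
        · have h1 := hF0 b hb.1 0 (by omega)
          have h2 := hF0 c hc.1 0 (by omega)
          omega
        · intro t ht
          rw [hcode b hb.2 t ht, hcode c hc.2 t ht]
        · intro t ht h4
          rw [hcode b hb.2 t ht] at h4
          have := congrFun hbc ⟨t, by simp [hT, ht, h4]⟩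
          simp only [Fin.mk.injEq] at this
          have h1 := hF0 b hb.1 (t+1) (by omega)
          have h2 := hF0 c hc.1 (t+1) (by omega)
          rwa [Nat.mod_eq_of_lt (by omega), Nat.mod_eq_of_lt (by omega)] at this
    rw [hcard] at this
    exact this.trans (Nat.pow_le_pow_right (by omega) (hcost a ha))
  have h1 := Finset.card_le_mul_card_image S (K ^ C) key
  have h2 : (S.image σ).card ≤ 5 ^ m := by
    refine (Finset.card_le_univ _).trans ?_
    simp
  calc S.card ≤ K ^ C * (S.image σ).card := h1
    _ ≤ K ^ C * 5 ^ m := Nat.mul_le_mul_left _ h2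
    _ = _ := mul_comm _ _

/-- Writer–reader counting bound: the number of equivalence relations `∼` on a nonempty
set `𝐧 ⊆ {1,…,2k}` such that (i) at most `ν` equivalence classes have degree `≥ 3` in the
graph `G_∼` on classes (where two distinct classes are adjacent whenever one contains the
immediate successor in `𝐧` of an element of the other), and (ii) each equivalence class
contains at most `κ` elements whose immediate successor in `𝐧` exists and lies outside
the class, is at most `5^{|𝐧|}·(2k)^{(κ−1)ν + 2}`. -/
theorem writer_reader_bound (k : ℕ) (hk : 1 ≤ k) (nset : Finset ℕ)
    (hsub : nset ⊆ Finset.Icc 1 (2 * k)) (hne : nset.Nonempty)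
    (κ ν : ℕ) (hκ : 1 ≤ κ) :
    {r : Setoid {i : ℕ // i ∈ nset} |
        ({c : Quotient r |
            3 ≤ {c' : Quotient r | c' ≠ c ∧
                  ∃ i j : {i : ℕ // i ∈ nset},
                    Quotient.mk r i = c ∧ Quotient.mk r j = c' ∧
                    (IsSuccIn nset (i : ℕ) (j : ℕ) ∨ IsSuccIn nset (j : ℕ) (i : ℕ))}.ncard
          }.ncard ≤ ν) ∧
        (∀ c : Quotient r,
          {i : {i : ℕ // i ∈ nset} | Quotient.mk r i = c ∧
              ∃ j : {i : ℕ // i ∈ nset},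
                IsSuccIn nset (i : ℕ) (j : ℕ) ∧ Quotient.mk r j ≠ c}.ncard ≤ κ)
      }.ncard ≤ 5 ^ nset.card * (2 * k) ^ ((κ - 1) * ν + 2) := by
  classical
  obtain ⟨A, B, hAB⟩ := wr_pick
  obtain ⟨m, hm⟩ : ∃ m, nset.card = m + 1 := ⟨nset.card - 1, by have := hne.card_pos; omega⟩
  have hcardle : nset.card ≤ 2 * k := by
    have := Finset.card_le_card hsub
    simpa using this
  let e := nset.orderIsoOfFin hm
  let el : ℕ → {i : ℕ // i ∈ nset} := fun t => e (Fin.ofNat (m+1) t)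
  have hlt : ∀ s t, s ≤ m → t ≤ m → (el s < el t ↔ s < t) := by
    intro s t hs ht
    simp only [el, OrderIso.lt_iff_lt, Fin.lt_def, Fin.ofNat]
    rw [Nat.mod_eq_of_lt (by omega), Nat.mod_eq_of_lt (by omega)]
  have hsurj : ∀ i, ∃ t ≤ m, el t = i := by
    intro i
    refine ⟨(e.symm i : Fin (m+1)), by omega, ?_⟩
    simp [el]
  have hinjel : ∀ s t, s ≤ m → t ≤ m → el s = el t → s = t := by
    intro s t hs ht h
    have h1 := hlt s t hs ht
    have h2 := hlt t s ht hs
    rw [h] at h1 h2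
    simp only [lt_irrefl, false_iff] at h1 h2
    omega
  have hsucc : ∀ t, t < m → IsSuccIn nset (el t : ℕ) (el (t+1) : ℕ) := by
    intro t ht
    refine ⟨(el (t+1)).2, (hlt t (t+1) (by omega) (by omega)).2 (by omega), ?_⟩
    intro x hx hlx
    obtain ⟨s, hs, hsx⟩ := hsurj ⟨x, hx⟩
    have h1 : el t < el s := by rw [hsx]; exact hlx
    rw [hlt t s (by omega) hs] at h1
    by_contra hcon
    have h2 : el s < el (t+1) := by
      rw [hsx]; exact lt_of_not_ge hcon
    rw [hlt s (t+1) hs (by omega)] at h2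
    omega
  have hex : ∀ (r : Setoid {i : ℕ // i ∈ nset}) (t : ℕ), ∃ s, r (el s) (el t) :=
    fun r t => ⟨t, r.refl _⟩
  let F : Setoid {i : ℕ // i ∈ nset} → ℕ → ℕ := fun r t => Nat.find (hex r t)
  have hFr : ∀ (r : Setoid {i : ℕ // i ∈ nset}) t, r (el (F r t)) (el t) := fun r t => Nat.find_spec (hex r t)
  have hFle : ∀ r t, F r t ≤ t := fun r t => Nat.find_min' (hex r t) (r.refl _)
  have hFeq : ∀ (r : Setoid {i : ℕ // i ∈ nset}) s t, F r s = F r t ↔ r (el s) (el t) := by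
    intro r s t
    constructor
    · intro h
      have h1 := hFr r s
      rw [h] at h1
      exact r.trans (r.symm h1) (hFr r t)
    · intro h
      apply le_antisymm
      · exact Nat.find_min' (hex r s) (r.trans (hFr r t) (r.symm h))
      · exact Nat.find_min' (hex r t) (r.trans (hFr r s) h)
  have hFF : ∀ r t, F r (F r t) = F r t := fun r t => (hFeq r _ _).2 (hFr r t)
  have hmk : ∀ (r : Setoid {i : ℕ // i ∈ nset}) t,
      Quotient.mk r (el (F r t)) = Quotient.mk r (el t) :=
    fun r t => Quotient.sound (hFr r t)
  have hmkeq : ∀ (r : Setoid {i : ℕ // i ∈ nset}) s t,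
      Quotient.mk r (el s) = Quotient.mk r (el t) ↔ F r s = F r t := by
    intro r s t
    rw [hFeq]
    exact Quotient.eq (r := r)
  have hfinS : Finite (Setoid {i : ℕ // i ∈ nset}) := by
    apply Finite.of_injective (fun r : Setoid {i : ℕ // i ∈ nset} => fun i j => r i j)
    intro r r' h
    ext i j
    exact iff_of_eq (congrFun (congrFun h i) j)
  rw [Set.ncard_eq_toFinset_card _ (Set.toFinite _)]
  have hpow : 5 ^ m * (2 * k) ^ ((κ - 1) * ν + 2) ≤ 5 ^ nset.card * (2 * k) ^ ((κ - 1) * ν + 2) :=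
    Nat.mul_le_mul_right _ (Nat.pow_le_pow_right (by omega) (by omega))
  refine le_trans (wr_count _ F A B m (2 * k) _ (by omega) ?_ ?_ ?_) hpow
  · intro r _ t _; exact hFle r t
  · intro r _ r' _ h
    ext i j
    obtain ⟨s, hs, rfl⟩ := hsurj i
    obtain ⟨t, ht, rfl⟩ := hsurj j
    rw [← hFeq, ← hFeq, h s hs, h t ht]
  · intro r hr
    rw [Set.Finite.mem_toFinset, Set.mem_ofPred_eq] at hr
    obtain ⟨hr1, hr2⟩ := hr
    apply wr_cost A B hAB (F r) m κ ν hκ (fun t _ => hFle r t) (fun t _ => hFF r t)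
    · refine le_trans ?_ hr1
      rw [← Set.ncard_coe_finset]
      apply Set.ncard_le_ncard_of_injOn (fun v => Quotient.mk r (el v)) _ _ (Set.toFinite _)
      · intro v hv
        simp only [Finset.coe_filter, Finset.mem_image, Finset.mem_range, Set.mem_ofPred_eq] at hv
        obtain ⟨⟨u, hu, rfl⟩, h3⟩ := hv
        rw [Set.mem_ofPred_eq]
        refine le_trans h3 ?_
        rw [← Set.ncard_coe_finset]
        apply Set.ncard_le_ncard_of_injOn (fun v => Quotient.mk r (el v)) _ _ (Set.toFinite _)
        · intro w hw
          simp only [wrN, Finset.coe_filter, Set.mem_ofPred_eq, Finset.mem_image,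
            Finset.mem_range] at hw
          obtain ⟨⟨x, hx, rfl⟩, hne', s, hs, h⟩ := hw
          refine ⟨?_, ?_⟩
          · intro hcon
            rw [hmkeq, hFF, hFF] at hcon
            exact hne' hcon
          · rcases h with ⟨h1, h2⟩ | ⟨h1, h2⟩
            · exact ⟨el s, el (s+1), by rw [← h1, hmk], by rw [← h2, hmk], Or.inl (hsucc s hs)⟩
            · exact ⟨el (s+1), el s, by rw [← h2, hmk], by rw [← h1, hmk], Or.inr (hsucc s hs)⟩
        · intro w hw w' hw' he
          simp only [wrN, Finset.coe_filter, Set.mem_ofPred_eq, Finset.mem_image,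
            Finset.mem_range] at hw hw'
          obtain ⟨⟨x, hx, rfl⟩, _⟩ := hw
          obtain ⟨⟨y, hy, rfl⟩, _⟩ := hw'
          simp only [hmkeq, hFF] at he
          exact he
      · intro w hw w' hw' he
        simp only [Finset.coe_filter, Set.mem_ofPred_eq, Finset.mem_image,
          Finset.mem_range] at hw hw'
        obtain ⟨⟨x, hx, rfl⟩, _⟩ := hw
        obtain ⟨⟨y, hy, rfl⟩, _⟩ := hw'
        simp only [hmkeq, hFF] at he
        exact he
    · intro v
      by_cases hv : ∃ u, F r u = v
      · obtain ⟨u, rfl⟩ := hv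
        refine le_trans ?_ (hr2 (Quotient.mk r (el u)))
        rw [← Set.ncard_coe_finset]
        apply Set.ncard_le_ncard_of_injOn el _ _ (Set.toFinite _)
        · intro t ht
          simp only [Finset.coe_filter, Set.mem_ofPred_eq, Finset.mem_range] at ht
          obtain ⟨h1, h2, h3⟩ := ht
          refine ⟨(hmkeq r _ _).2 h2, el (t+1), hsucc t h1, ?_⟩
          rw [Ne, hmkeq]
          exact h3
        · intro s hs t ht he
          simp only [Finset.coe_filter, Set.mem_ofPred_eq, Finset.mem_range] at hs ht
          exact hinjel s t (by omega) (by omega) he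
      · rw [Finset.filter_false_of_mem]
        · simp
        · intro t _ h
          exact hv ⟨t, h.1⟩
end

section
/- Sieve with composite moduli: Let 𝒬 be a finite collection of distinct arithmetic progressions in ℤ, each with squarefree modulus. Let 𝒬^∩ = {⋂𝒮 : 𝒮 ⊆ 𝒬} (with ⋂∅ = ℤ). Let 𝔇 be a nonempty subset of 𝒬^∩ with ∅ ∉ 𝔇, closed under containment (if R ∈ 𝔇 and R ⊆ R' with R' ∈ 𝒬^∩, then R' ∈ 𝔇). Define F_𝔇(n) = ∑_{𝒮 ⊆ 𝒬, ⋂𝒮 ∈ 𝔇} (−1)^{|𝒮|} · 1_{n ∈ ⋂𝒮}, and ∂𝔇 = {R ∈ 𝔇 : ∃ P ∈ 𝒬 with P ∩ R ∉ 𝔇}. Then: (a) for every n ∈ ℤ, |1_{n ∉ P for all P ∈ 𝒬} − F_𝔇(n)| ≤ ∑_{R ∈ ∂𝔇} 2^{ω(𝔮(R))} · 1_{n ∈ R}; and (b) there are integers c_R for R ∈ 𝔇 with |c_R| ≤ 2^{ω(𝔮(R))} such that F_𝔇(n) = ∑_{R ∈ 𝔇} c_R · 1_{n ∈ R} for all n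 ∈ ℤ. -/
open scoped Classical

lemma comb_bound {α ι : Type*} (r : α → ι → Prop) (K : Finset ι) : ∀ Q : Finset α,
    |∑ S ∈ Q.powerset.filter (fun S => ∀ p ∈ K, ∃ P ∈ S, r P p), (-1 : ℤ) ^ S.card|
      ≤ 2 ^ K.card := by
  induction K using Finset.induction_on with
  | empty =>
    intro Q
    simp only [Finset.notMem_empty, false_imp_iff, implies_true, Finset.filter_true,
      Finset.sum_powerset_neg_one_pow_card]
    split_ifs <;> simp
  | insert p K hp ih =>
    intro Q
    have h1 := ih Q
    have h2 := ih (Q.filter (fun P => ¬ r P p))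
    have h3 : ∑ S ∈ Q.powerset.filter (fun S => ∀ p ∈ K, ∃ P ∈ S, r P p), (-1 : ℤ) ^ S.card
        = ∑ S ∈ Q.powerset.filter (fun S => ∀ x ∈ insert p K, ∃ P ∈ S, r P x), (-1 : ℤ) ^ S.card
        + ∑ S ∈ (Q.filter (fun P => ¬ r P p)).powerset.filter
            (fun S => ∀ p ∈ K, ∃ P ∈ S, r P p), (-1 : ℤ) ^ S.card := by
      rw [← Finset.sum_filter_add_sum_filter_not _ (fun S => ∃ P ∈ S, r P p)]
      congr 1
      · apply Finset.sum_congr _ (fun _ _ => rfl)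
        ext S
        simp only [Finset.mem_filter, Finset.mem_powerset, Finset.forall_mem_insert]
        tauto
      · apply Finset.sum_congr _ (fun _ _ => rfl)
        ext S
        simp only [Finset.mem_filter, Finset.mem_powerset, Finset.subset_iff]
        push Not
        constructor
        · rintro ⟨⟨a, b⟩, c⟩
          exact ⟨fun x hx => ⟨a hx, c x hx⟩, b⟩
        · rintro ⟨a, b⟩
          exact ⟨⟨fun x hx => (a hx).1, b⟩, fun x hx => (a hx).2⟩
    rw [Finset.card_insert_of_notMem hp, pow_succ]
    rw [abs_le] at *
    constructor <;> linarith

lemma dvd_div_aux {q m p : ℕ} (hp : p.Prime) (hq : Squarefree q) (hqm : q ∣ m)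
    (hpp : p * p ∣ m) : q ∣ m / p := by
  obtain ⟨k, rfl⟩ := hpp
  rw [mul_assoc, Nat.mul_div_cancel_left _ hp.pos]
  rw [mul_assoc] at hqm
  by_cases h : p ∣ q
  · obtain ⟨t, rfl⟩ := h
    have hc : Nat.Coprime p t := Nat.coprime_of_squarefree_mul hq
    have h1 : t ∣ p * k := Nat.dvd_of_mul_dvd_mul_left hp.pos hqm
    exact mul_dvd_mul_left p (hc.symm.dvd_of_dvd_mul_left h1)
  · exact (((Nat.Prime.coprime_iff_not_dvd hp).2 h).symm).dvd_of_dvd_mul_left hqm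

lemma coef_bound (Q0 : Finset (Set ℤ)) (q : Set ℤ → ℕ)
    (hq : ∀ P ∈ Q0, Squarefree (q P) ∧ ∀ a ∈ P, ∀ n, n ∈ P ↔ (q P : ℤ) ∣ n - a)
    (R : Set ℤ) (hne : R ≠ ∅) (S0 : Finset (Set ℤ)) (hS0 : S0 ⊆ Q0)
    (hR : R = ⋂₀ (S0 : Set (Set ℤ))) (m : ℕ)
    (hm : 0 < m ∧ (∀ n : ℤ, n ∈ R ↔ n + m ∈ R) ∧
      ∀ k : ℕ, 0 < k → (∀ n : ℤ, n ∈ R ↔ n + k ∈ R) → m ≤ k)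
    (Q : Finset (Set ℤ)) (hQ : Q ⊆ Q0) :
    |∑ S ∈ Q.powerset.filter (fun S : Finset (Set ℤ) => ⋂₀ (↑S : Set (Set ℤ)) = R),
      (-1 : ℤ) ^ S.card| ≤ 2 ^ m.primeFactors.card := by
  obtain ⟨hm0, hper, hmin⟩ := hm
  obtain ⟨a, ha⟩ := Set.nonempty_iff_ne_empty.2 hne
  have hdiv : ∀ P ∈ Q0, R ⊆ P → q P ∣ m := by
    intro P hP hRP
    have := ((hq P hP).2 a (hRP ha) (a + m)).1 (hRP ((hper a).1 ha))
    rw [add_sub_cancel_left] at this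
    exact_mod_cast this
  have hshift : ∀ P ∈ Q0, ∀ k : ℕ, q P ∣ k → ∀ n : ℤ, n ∈ P ↔ n + k ∈ P := by
    intro P hP k hk n
    have hk' : (q P : ℤ) ∣ k := by exact_mod_cast hk
    constructor
    · intro h
      rw [(hq P hP).2 n h, add_sub_cancel_left]
      exact hk'
    · intro h
      rw [(hq P hP).2 _ h]
      simpa using hk'
  have key : ∀ S : Finset (Set ℤ), S ⊆ Q0 → ⋂₀ (S : Set (Set ℤ)) = R → ∀ p : ℕ, p.Prime →
      p ∣ m → (∀ P ∈ S, q P ∣ m / p) → False := by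
    intro S hS hSR p hp hpm h
    have h1 := hmin (m / p) (Nat.div_pos (Nat.le_of_dvd hm0 hpm) hp.pos) (by
      intro n
      rw [← hSR]
      simp only [Set.mem_sInter, Finset.mem_coe]
      exact forall₂_congr fun P hP => hshift P (hS hP) _ (h P hP) n)
    exact absurd (Nat.div_lt_self hm0 hp.one_lt) (not_lt.2 h1)
  have hsub : ∀ S : Finset (Set ℤ), ⋂₀ (S : Set (Set ℤ)) = R → ∀ P ∈ S, R ⊆ P := by
    intro S hS P hP
    rw [← hS]
    exact Set.sInter_subset_of_mem hP
  have hsq : Squarefree m := by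
    rw [Nat.squarefree_iff_prime_squarefree]
    intro p hp hpp
    exact key S0 hS0 hR.symm p hp (dvd_of_mul_left_dvd hpp) fun P hP =>
      dvd_div_aux hp (hq P (hS0 hP)).1 (hdiv P (hS0 hP) (hsub S0 hR.symm P hP)) hpp
  have hmR : ∀ n : ℤ, (m : ℤ) ∣ n - a → n ∈ R := by
    intro n hn
    rw [hR] 
    intro P hP
    have hRP := hsub S0 hR.symm P hP
    rw [(hq P (hS0 hP)).2 a (hRP ha)]
    exact dvd_trans (by exact_mod_cast hdiv P (hS0 hP) hRP) hn
  have heq : Q.powerset.filter (fun S : Finset (Set ℤ) => ⋂₀ (↑S : Set (Set ℤ)) = R) =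
      (Q.filter (fun P => R ⊆ P)).powerset.filter
        (fun S => ∀ p ∈ m.primeFactors, ∃ P ∈ S, p ∣ q P) := by
    ext S
    simp only [Finset.mem_filter, Finset.mem_powerset]
    constructor
    · rintro ⟨hSQ, hSR⟩
      refine ⟨fun P hP => Finset.mem_filter.2 ⟨hSQ hP, hsub S hSR P hP⟩, ?_⟩
      intro p hp
      by_contra hcon
      push Not at hcon
      have hpp := Nat.prime_of_mem_primeFactors hp
      have hpm := Nat.dvd_of_mem_primeFactors hp
      refine key S (hSQ.trans hQ) hSR p hpp hpm fun P hP => ?_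
      have h1 := hdiv P (hQ (hSQ hP)) (hsub S hSR P hP)
      rw [← Nat.mul_div_cancel' hpm] at h1
      exact (((Nat.Prime.coprime_iff_not_dvd hpp).2 (hcon P hP)).symm).dvd_of_dvd_mul_left h1
    · rintro ⟨hSQ, hS⟩
      refine ⟨hSQ.trans (Finset.filter_subset _ _), ?_⟩
      apply Set.Subset.antisymm
      · intro n hn
        apply hmR
        have h2 : m ∣ (n - a).natAbs := by
          rw [← Nat.prod_primeFactors_of_squarefree hsq]
          apply Finset.prod_primes_dvd
          · intro p hp
            exact (Nat.prime_of_mem_primeFactors hp).prime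
          · intro p hp
            obtain ⟨P, hP, hpP⟩ := hS p hp
            have hPQ := Finset.mem_filter.1 (hSQ hP)
            have h3 := ((hq P (hQ hPQ.1)).2 a (hPQ.2 ha) n).1 (hn P hP)
            exact hpP.trans (Int.natCast_dvd.1 h3)
        exact Int.natCast_dvd.2 h2
      · apply Set.subset_sInter
        intro P hP
        exact (Finset.mem_filter.1 (hSQ hP)).2
  rw [heq]
  exact comb_bound (fun P p => p ∣ q P) m.primeFactors _

/-- Sieve with composite moduli. `𝒬` is a finite collection of (distinct) arithmetic
progressions in `ℤ` with squarefree moduli, `𝔇 ⊆ 𝒬^∩` is nonempty, does not contain `∅`,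
and is closed under containment; `modulus R` is the modulus of a progression `R`
(the least positive period). Then (a) the indicator of `{n : n lies in no P ∈ 𝒬}` is
approximated by `F_𝔇(n) = ∑_{𝒮 ⊆ 𝒬, ⋂𝒮 ∈ 𝔇} (−1)^{|𝒮|} 1_{n ∈ ⋂𝒮}` with error at most
`∑_{R ∈ ∂𝔇} 2^{ω(𝔮(R))} 1_{n ∈ R}`, and (b) `F_𝔇(n) = ∑_{R ∈ 𝔇} c_R 1_{n ∈ R}` with
`|c_R| ≤ 2^{ω(𝔮(R))}`. -/
theorem sieve_composite_moduli
    (Q : Finset (Set ℤ))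
    (hQ : ∀ P ∈ Q, ∃ a : ℤ, ∃ q : ℕ, 0 < q ∧ Squarefree q ∧
      P = {n : ℤ | (q : ℤ) ∣ n - a})
    (D : Finset (Set ℤ))
    (hDsub : ∀ R ∈ D, ∃ S ∈ Q.powerset, R = ⋂₀ (S : Set (Set ℤ)))
    (hDne : D.Nonempty) (hDempty : (∅ : Set ℤ) ∉ D)
    (hDclosed : ∀ R ∈ D, ∀ S ∈ Q.powerset,
      R ⊆ ⋂₀ (S : Set (Set ℤ)) → ⋂₀ (S : Set (Set ℤ)) ∈ D)
    (modulus : Set ℤ → ℕ)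
    (hmod : ∀ R ∈ D, 0 < modulus R ∧ (∀ n : ℤ, n ∈ R ↔ n + modulus R ∈ R) ∧
      ∀ m : ℕ, 0 < m → (∀ n : ℤ, n ∈ R ↔ n + m ∈ R) → modulus R ≤ m) :
    (∀ n : ℤ,
      |(if ∀ P ∈ Q, n ∉ P then (1 : ℤ) else 0) -
          ∑ S ∈ Q.powerset.filter (fun S : Finset (Set ℤ) => ⋂₀ (↑S : Set (Set ℤ)) ∈ D),
            (-1) ^ S.card * (if n ∈ ⋂₀ (↑S : Set (Set ℤ)) then (1 : ℤ) else 0)| ≤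
        ∑ R ∈ D.filter (fun R => ∃ P ∈ Q, P ∩ R ∉ D),
          2 ^ (modulus R).primeFactors.card * (if n ∈ R then (1 : ℤ) else 0)) ∧
    (∃ c : Set ℤ → ℤ,
      (∀ R ∈ D, |c R| ≤ 2 ^ (modulus R).primeFactors.card) ∧
      ∀ n : ℤ,
        (∑ S ∈ Q.powerset.filter (fun S : Finset (Set ℤ) => ⋂₀ (↑S : Set (Set ℤ)) ∈ D),
          (-1) ^ S.card * (if n ∈ ⋂₀ (↑S : Set (Set ℤ)) then (1 : ℤ) else 0)) =
        ∑ R ∈ D, c R * (if n ∈ R then (1 : ℤ) else 0)) := by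
  have hchoose : ∀ P : Set ℤ, ∃ q : ℕ, P ∈ Q →
      (Squarefree q ∧ ∀ a ∈ P, ∀ n, n ∈ P ↔ (q : ℤ) ∣ n - a) := by
    intro P
    by_cases hP : P ∈ Q
    · obtain ⟨a, q, _, hsq, rfl⟩ := hQ P hP
      refine ⟨q, fun _ => ⟨hsq, ?_⟩⟩
      intro b hb n
      simp only [Set.mem_ofPred_eq] at hb ⊢
      have : n - a = (n - b) + (b - a) := by ring
      rw [this]
      exact dvd_add_left hb
    · exact ⟨0, fun h => absurd h hP⟩
  choose q hq using hchoose
  have hcoef : ∀ R ∈ D, ∀ Q' ⊆ Q,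
      |∑ S ∈ Q'.powerset.filter (fun S : Finset (Set ℤ) => ⋂₀ (↑S : Set (Set ℤ)) = R),
      (-1 : ℤ) ^ S.card| ≤ 2 ^ (modulus R).primeFactors.card := by
    intro R hR Q' hQ'
    obtain ⟨S0, hS0, hRS⟩ := hDsub R hR
    exact coef_bound Q q hq R (fun h => hDempty (h ▸ hR)) S0 (Finset.mem_powerset.1 hS0) hRS _
      (hmod R hR) Q' hQ'
  constructor
  · intro n
    by_cases hn : ∀ P ∈ Q, n ∉ P
    · have huniv : ⋂₀ ((∅ : Finset (Set ℤ)) : Set (Set ℤ)) ∈ D := by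
        obtain ⟨R, hR⟩ := hDne
        exact hDclosed R hR ∅ (by simp) (by simp)
      have hF : ∑ S ∈ Q.powerset.filter (fun S : Finset (Set ℤ) => ⋂₀ (↑S : Set (Set ℤ)) ∈ D),
            (-1) ^ S.card * (if n ∈ ⋂₀ (↑S : Set (Set ℤ)) then (1 : ℤ) else 0) = 1 := by
        rw [Finset.sum_eq_single (∅ : Finset (Set ℤ))]
        · simp
        · intro S hS hSne
          obtain ⟨P, hP⟩ := Finset.nonempty_iff_ne_empty.2 hSne
          have hSQ := Finset.mem_powerset.1 (Finset.mem_filter.1 hS).1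
          rw [if_neg, mul_zero]
          intro h
          exact hn P (hSQ hP) (h P hP)
        · intro h
          refine absurd ?_ h
          rw [Finset.mem_filter]
          exact ⟨Finset.empty_mem_powerset _, huniv⟩
      rw [hF, if_pos hn]
      simp only [sub_self, abs_zero]
      apply Finset.sum_nonneg
      intro R _
      split_ifs <;> simp
    · rw [if_neg hn]
      push Not at hn
      obtain ⟨P0, hP0, hnP0⟩ := hn
      set Q' := Q.erase P0 with hQ'
      have hQQ' : Q' ⊆ Q := Finset.erase_subset _ _
      have hins : insert P0 Q' = Q := Finset.insert_erase hP0
      have hP0' : P0 ∉ Q' := Finset.notMem_erase _ _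
      have hF : ∑ S ∈ Q.powerset.filter (fun S : Finset (Set ℤ) => ⋂₀ (↑S : Set (Set ℤ)) ∈ D),
            (-1) ^ S.card * (if n ∈ ⋂₀ (↑S : Set (Set ℤ)) then (1 : ℤ) else 0) =
          ∑ R ∈ D.filter (fun R => P0 ∩ R ∉ D),
            (∑ S ∈ Q'.powerset.filter (fun S : Finset (Set ℤ) => ⋂₀ (↑S : Set (Set ℤ)) = R),
              (-1 : ℤ) ^ S.card) * (if n ∈ R then (1 : ℤ) else 0) := by
        have h1 : ∀ R ∈ D.filter (fun R => P0 ∩ R ∉ D),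
            (∑ S ∈ Q'.powerset.filter (fun S : Finset (Set ℤ) => ⋂₀ (↑S : Set (Set ℤ)) = R),
              (-1 : ℤ) ^ S.card) * (if n ∈ R then (1 : ℤ) else 0) =
            ∑ S ∈ Q'.powerset, if ⋂₀ (↑S : Set (Set ℤ)) = R then
              (-1 : ℤ) ^ S.card * (if n ∈ ⋂₀ (↑S : Set (Set ℤ)) then (1 : ℤ) else 0) else 0 := by
          intro R _
          rw [Finset.sum_filter, Finset.sum_mul]
          refine Finset.sum_congr rfl fun S _ => ?_
          by_cases h : ⋂₀ (↑S : Set (Set ℤ)) = R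
          · simp only [h, if_true]
          · simp only [h, if_false, zero_mul]
        rw [Finset.sum_congr rfl h1, Finset.sum_comm, Finset.sum_filter]
        conv_lhs => rw [← hins]
        rw [Finset.sum_powerset_insert hP0', ← Finset.sum_add_distrib]
        refine Finset.sum_congr rfl fun S hS => ?_
        have hSQ' := Finset.mem_powerset.1 hS
        rw [Finset.sum_ite_eq, Finset.card_insert_of_notMem (fun h => hP0' (hSQ' h)),
          Finset.coe_insert, Set.sInter_insert]
        have hcl : P0 ∩ ⋂₀ (↑S : Set (Set ℤ)) ∈ D → ⋂₀ (↑S : Set (Set ℤ)) ∈ D := fun h =>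
          hDclosed _ h S (Finset.mem_powerset.2 (hSQ'.trans hQQ')) Set.inter_subset_right
        simp only [Finset.mem_filter, Set.mem_inter_iff, hnP0, true_and, pow_succ]
        by_cases hA : P0 ∩ ⋂₀ (↑S : Set (Set ℤ)) ∈ D
        · simp only [hA, hcl hA, if_true, not_true, and_false, if_false]
          ring
        · by_cases hB : ⋂₀ (↑S : Set (Set ℤ)) ∈ D <;> simp [hA, hB]
      rw [hF, zero_sub, abs_neg]
      calc _ ≤ ∑ R ∈ D.filter (fun R => P0 ∩ R ∉ D),
            |(∑ S ∈ Q'.powerset.filter (fun S : Finset (Set ℤ) => ⋂₀ (↑S : Set (Set ℤ)) = R),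
              (-1 : ℤ) ^ S.card) * (if n ∈ R then (1 : ℤ) else 0)| :=
            Finset.abs_sum_le_sum_abs _ _
        _ ≤ ∑ R ∈ D.filter (fun R => P0 ∩ R ∉ D),
            2 ^ (modulus R).primeFactors.card * (if n ∈ R then (1 : ℤ) else 0) := by
            refine Finset.sum_le_sum fun R hR => ?_
            have := hcoef R (Finset.mem_filter.1 hR).1 Q' hQQ'
            by_cases h : n ∈ R
            · simpa [h] using this
            · simp [h]
        _ ≤ _ := by
            refine Finset.sum_le_sum_of_subset_of_nonneg ?_ ?_
            · intro R hR
              rw [Finset.mem_filter] at hR ⊢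
              exact ⟨hR.1, P0, hP0, hR.2⟩
            · intro R _ _
              split_ifs <;> simp
  · refine ⟨fun R => ∑ S ∈ Q.powerset.filter
      (fun S : Finset (Set ℤ) => ⋂₀ (↑S : Set (Set ℤ)) = R), (-1 : ℤ) ^ S.card,
      fun R hR => hcoef R hR Q (Finset.Subset.refl _), ?_⟩
    intro n
    have h1 : ∀ R ∈ D,
        (∑ S ∈ Q.powerset.filter (fun S : Finset (Set ℤ) => ⋂₀ (↑S : Set (Set ℤ)) = R),
          (-1 : ℤ) ^ S.card) * (if n ∈ R then (1 : ℤ) else 0) =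
        ∑ S ∈ Q.powerset, if ⋂₀ (↑S : Set (Set ℤ)) = R then
          (-1 : ℤ) ^ S.card * (if n ∈ ⋂₀ (↑S : Set (Set ℤ)) then (1 : ℤ) else 0) else 0 := by
      intro R _
      rw [Finset.sum_filter, Finset.sum_mul]
      refine Finset.sum_congr rfl fun S _ => ?_
      by_cases h : ⋂₀ (↑S : Set (Set ℤ)) = R
      · simp only [h, if_true]
      · simp only [h, if_false, zero_mul]
    simp only []
    rw [Finset.sum_congr rfl h1, Finset.sum_comm, Finset.sum_filter]
    refine Finset.sum_congr rfl fun S _ => ?_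
    rw [Finset.sum_ite_eq]
end

section
/- Cross-cut bound: Let X be a finite set and let 𝒞 be a finite collection of subsets of X. Then |∑_{𝒮 ⊆ 𝒞, ⋃𝒮 = X} (−1)^{|𝒮|}| ≤ 2^{|X|}, where the sum ranges over all subcollections 𝒮 of 𝒞 whose union is X. -/
/-- Cross-cut bound: for a finite set `X` and a collection `𝒞` of subsets of `X`,
`|∑_{𝒮 ⊆ 𝒞, ⋃𝒮 = X} (−1)^{|𝒮|}| ≤ 2^{|X|}`. -/
theorem crosscut_bound {α : Type*} [DecidableEq α] (X : Finset α) (C : Finset (Finset α))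
    (hC : ∀ S ∈ C, S ⊆ X) :
    |∑ S ∈ C.powerset.filter (fun S => S.biUnion id = X), (-1 : ℤ) ^ S.card| ≤
      2 ^ X.card := by
  have key : ∑ S ∈ C.powerset.filter (fun S => S.biUnion id = X), (-1 : ℤ) ^ S.card
      = ∑ Y ∈ X.powerset, (-1 : ℤ) ^ Y.card *
          ∑ S ∈ (C.filter (fun c => Disjoint c Y)).powerset, (-1 : ℤ) ^ S.card := by
    rw [Finset.sum_filter]
    have h1 : ∀ S ∈ C.powerset, (if S.biUnion id = X then (-1 : ℤ) ^ S.card else 0)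
        = ∑ Y ∈ (X \ S.biUnion id).powerset, (-1 : ℤ) ^ Y.card * (-1 : ℤ) ^ S.card := by
      intro S hS
      rw [← Finset.sum_mul, Finset.sum_powerset_neg_one_pow_card]
      have hsub : S.biUnion id ⊆ X :=
        Finset.biUnion_subset.2 fun c hc => hC c (Finset.mem_powerset.1 hS hc)
      have : S.biUnion id = X ↔ X \ S.biUnion id = ∅ := by
        rw [Finset.sdiff_eq_empty_iff_subset]
        exact ⟨fun h => h.ge, fun h => hsub.antisymm h⟩
      simp only [this]
      split_ifs <;> simp
    rw [Finset.sum_congr rfl h1]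
    simp only [Finset.mul_sum]
    apply Finset.sum_comm'
    intro S Y
    simp only [Finset.mem_powerset, Finset.subset_sdiff, Finset.disjoint_biUnion_right, id]
    constructor
    · rintro ⟨h, h2, h3⟩
      exact ⟨fun c hc => Finset.mem_filter.2 ⟨h hc, (h3 c hc).symm⟩, h2⟩
    · rintro ⟨h, h2⟩
      exact ⟨fun c hc => (Finset.mem_filter.1 (h hc)).1, h2,
        fun c hc => (Finset.mem_filter.1 (h hc)).2.symm⟩
  rw [key]
  refine (Finset.abs_sum_le_sum_abs _ _).trans ?_
  refine (Finset.sum_le_card_nsmul _ _ 1 ?_).trans ?_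
  · intro Y _
    rw [Finset.sum_powerset_neg_one_pow_card, abs_mul, abs_pow]
    split_ifs <;> simp
  · simp
end

section
/- Skew-symmetric minor theorem: Let M be an n-by-n skew-symmetric matrix over ℝ of rank r. Then there exist disjoint subsets I, J of {1, …, n} such that the submatrix (M_{i,j})_{i ∈ I, j ∈ J} has rank at least r/2. -/
open Matrix

lemma skew_step {κ : Type*} [Fintype κ] [DecidableEq κ] (N N1 : Matrix κ κ ℝ)
    (h1 : ∀ i j, N1 i j = - N1 j i) (i : κ)
    (hag : ∀ a b, a ≠ i → b ≠ i → N1 a b = N a b)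
    (k : κ → ℝ) (hk : N *ᵥ k = Pi.single i 1) (hki : k i = 0)
    (hnon : ∀ p, N *ᵥ p = 0 → p = 0)
    (hc : (N1 *ᵥ k) i ≠ 0) : ∀ p, N1 *ᵥ p = 0 → p = 0 := by
  have key : ∀ p : κ → ℝ, p i = 0 → ∀ a, a ≠ i → (N1 *ᵥ p) a = (N *ᵥ p) a := by
    intro p hp a ha
    simp only [mulVec, dotProduct]
    refine Finset.sum_congr rfl fun b _ => ?_
    by_cases hb : b = i
    · simp [hb, hp]
    · rw [hag a b ha hb]
  have hN1k : N1 *ᵥ k = Pi.single i ((N1 *ᵥ k) i) := by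
    ext a
    by_cases ha : a = i
    · subst ha; simp
    · rw [key k hki a ha, hk]; simp [ha]
  intro p hp
  have hpi : p i = 0 := by
    have e : p ⬝ᵥ (N1 *ᵥ k) = - ((N1 *ᵥ p) ⬝ᵥ k) := by
      have : N1ᵀ = - N1 := by ext a b; simp [h1 b a]
      rw [dotProduct_mulVec, ← mulVec_transpose, this, neg_mulVec, neg_dotProduct]
    rw [hp, hN1k] at e
    simp at e
    exact e.resolve_right hc
  have hNp : N *ᵥ p = Pi.single i ((N *ᵥ p) i) := by
    ext a
    by_cases ha : a = i
    · subst ha; simp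
    · rw [← key p hpi a ha, hp]; simp [ha]
  set t := (N *ᵥ p) i with ht
  have hpk : p - t • k = 0 := by
    apply hnon
    rw [mulVec_sub, mulVec_smul, hk, hNp]
    ext a
    by_cases ha : a = i
    · subst ha; simp
    · simp [ha]
  have hpk' : p = t • k := sub_eq_zero.mp hpk
  have : t = 0 := by
    have h := congrFun hp i
    rw [hpk', mulVec_smul] at h
    simp at h
    exact h.resolve_right hc
  rw [hpk', this, zero_smul]

lemma skew_signs {κ : Type*} [Fintype κ] [DecidableEq κ] (A : Matrix κ κ ℝ)
    (hA : ∀ i j, A i j = - A j i) (hnon : ∀ p, A *ᵥ p = 0 → p = 0) (s : Finset κ) :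
    ∃ d : κ → ℝ, (∀ i ∈ s, d i = 1 ∨ d i = -1) ∧ (∀ i, i ∉ s → d i = 0) ∧
      ∀ p, (Matrix.of fun i j => A i j * (1 - d i * d j)) *ᵥ p = 0 → p = 0 := by
  induction s using Finset.induction_on with
  | empty =>
    refine ⟨0, by simp, by simp, ?_⟩
    intro p hp
    apply hnon
    rw [← hp]; congr 1; ext i j; simp
  | insert i s his ih =>
    obtain ⟨d, hd1, hd0, hd⟩ := ih
    set F : (κ → ℝ) → Matrix κ κ ℝ := fun d => Matrix.of fun i j => A i j * (1 - d i * d j) with hF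
    have hFs : ∀ d a b, F d a b = - F d b a := by
      intro d a b; simp only [hF, of_apply]; rw [hA a b]; ring
    have hdi := hd0 i his
    obtain ⟨k, hk⟩ : ∃ k, F d *ᵥ k = Pi.single i 1 := by
      have inj : Function.Injective (Matrix.mulVecLin (F d)) := by
        rw [← LinearMap.ker_eq_bot, LinearMap.ker_eq_bot']
        intro p hp; exact hd p hp
      exact (LinearMap.injective_iff_surjective.mp inj) (Pi.single i 1)
    have hki : k i = 0 := by
      have e : k ⬝ᵥ (F d *ᵥ k) = - ((F d *ᵥ k) ⬝ᵥ k) := by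
        have : (F d)ᵀ = - F d := by ext a b; rw [transpose_apply, neg_apply, hFs]
        conv_lhs => rw [dotProduct_mulVec, ← mulVec_transpose, this, neg_mulVec, neg_dotProduct]
      rw [hk] at e
      simp at e
      linarith
    have hag : ∀ c : ℝ, ∀ a b, a ≠ i → b ≠ i → F (Function.update d i c) a b = F d a b := by
      intro c a b ha hb
      simp [hF, ha, hb]
    have hsum : (F (Function.update d i 1) *ᵥ k) i + (F (Function.update d i (-1)) *ᵥ k) i = 2 := by
      have h2 : (F d *ᵥ k) i = 1 := by rw [hk]; simp
      have : (2:ℝ) = 2 * (F d *ᵥ k) i := by rw [h2]; norm_num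
      rw [this]
      simp only [mulVec, dotProduct]
      rw [← Finset.sum_add_distrib, Finset.mul_sum]
      refine Finset.sum_congr rfl fun b _ => ?_
      by_cases hb : b = i
      · simp [hb, hki]
      · simp [hF, hb, hdi]; ring
    have fin : ∀ c : ℝ, (c = 1 ∨ c = -1) → (F (Function.update d i c) *ᵥ k) i ≠ 0 →
        ∃ d : κ → ℝ, (∀ j ∈ insert i s, d j = 1 ∨ d j = -1) ∧ (∀ j, j ∉ insert i s → d j = 0) ∧
          ∀ p, F d *ᵥ p = 0 → p = 0 := by
      intro c hc hne
      refine ⟨Function.update d i c, ?_, ?_, skew_step (F d) _ (hFs _) i (hag c) k hk hki hd hne⟩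
      · intro j hj
        by_cases hji : j = i
        · subst hji; simpa using hc
        · simpa [hji] using hd1 j (by simpa [hji] using hj)
      · intro j hj
        simp only [Finset.mem_insert, not_or] at hj
        simpa [hj.1] using hd0 j hj.2
    by_cases h : (F (Function.update d i 1) *ᵥ k) i = 0
    · exact fin (-1) (Or.inr rfl) (by intro h'; rw [h, h'] at hsum; norm_num at hsum)
    · exact fin 1 (Or.inl rfl) h

lemma my_rank_add {κ : Type*} [Fintype κ] (A B : Matrix κ κ ℝ) :
    (A + B).rank ≤ A.rank + B.rank := by
  unfold Matrix.rank
  refine le_trans (Submodule.finrank_mono ?_)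
    (Submodule.finrank_add_le_finrank_add_finrank (LinearMap.range A.mulVecLin)
      (LinearMap.range B.mulVecLin))
  rintro _ ⟨p, rfl⟩
  rw [mulVecLin_add]
  exact Submodule.add_mem_sup ⟨p, rfl⟩ ⟨p, rfl⟩

/-- Skew-symmetric minor theorem: a real skew-symmetric `n × n` matrix of rank `r` has a
minor with disjoint row and column index sets of rank at least `r/2`. -/
theorem skew_symmetric_minor {n : ℕ} (M : Matrix (Fin n) (Fin n) ℝ)
    (hskew : M.transpose = -M) :
    ∃ I J : Finset (Fin n), Disjoint I J ∧
      (M.rank : ℝ) / 2 ≤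
        ((M.submatrix (fun i : {x : Fin n // x ∈ I} => (i : Fin n))
          (fun j : {x : Fin n // x ∈ J} => (j : Fin n))).rank : ℝ) := by
  classical
  have hM : ∀ i j, M i j = - M j i := fun i j => by
    have := congrFun (congrFun hskew j) i
    simpa using this
  obtain ⟨κ, a, ha, hspan, hli⟩ := exists_linearIndependent' ℝ M.row
  have : Finite κ := Finite.of_injective a ha
  have : Fintype κ := Fintype.ofFinite κ
  have hrank : M.rank = Fintype.card κ := by
    rw [rank_eq_finrank_span_row, ← hspan, finrank_span_eq_card hli]
  set A : Matrix κ κ ℝ := M.submatrix a a with hAdef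
  have hA : ∀ i j, A i j = - A j i := fun i j => hM _ _
  have hnon : ∀ p, A *ᵥ p = 0 → p = 0 := by
    intro p hp
    let φ : (Fin n → ℝ) →ₗ[ℝ] ℝ := ∑ k, p k • LinearMap.proj (a k)
    have hφ : ∀ v, φ v = ∑ k, p k * v (a k) := by intro v; simp [φ]
    have hle : Submodule.span ℝ (Set.range (M.row ∘ a)) ≤ LinearMap.ker φ := by
      rw [Submodule.span_le]
      rintro _ ⟨j, rfl⟩
      have := congrFun hp j
      simp only [SetLike.mem_coe, LinearMap.mem_ker, hφ]
      refine Eq.trans ?_ this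
      simp [mulVec, dotProduct, A, mul_comm]
    rw [hspan] at hle
    have hz : ∑ k, p k • (M.row ∘ a) k = 0 := by
      ext m
      have h : φ (M.row m) = 0 := hle (Submodule.subset_span ⟨m, rfl⟩)
      rw [hφ] at h
      simp only [Finset.sum_apply, Pi.smul_apply, Function.comp, smul_eq_mul, Pi.zero_apply, row]
      rw [← neg_eq_zero, ← h, ← Finset.sum_neg_distrib]
      refine Finset.sum_congr rfl fun k _ => ?_
      rw [hM (a k) m]; simp [row]
    ext k
    exact Fintype.linearIndependent_iff.mp hli p hz k
  obtain ⟨d, hd, -, hN⟩ := skew_signs A hA hnon Finset.univ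
  set N : Matrix κ κ ℝ := Matrix.of fun i j => A i j * (1 - d i * d j) with hNdef
  have hNrank : N.rank = Fintype.card κ := by
    have inj : Function.Injective (Matrix.mulVecLin N) := by
      rw [← LinearMap.ker_eq_bot, LinearMap.ker_eq_bot']
      intro p hp; exact hN p hp
    rw [Matrix.rank, LinearMap.finrank_range_of_inj inj, Module.finrank_fintype_fun_eq_card]
  let I : Finset (Fin n) := (Finset.univ.filter fun k => d k = 1).image a
  let J : Finset (Fin n) := (Finset.univ.filter fun k => d k = -1).image a
  have hI : ∀ k, a k ∈ I ↔ d k = 1 := by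
    intro k; simp [I, ha.eq_iff]
  have hJ : ∀ k, a k ∈ J ↔ d k = -1 := by
    intro k; simp [J, ha.eq_iff]
  refine ⟨I, J, ?_, ?_⟩
  · rw [Finset.disjoint_left]
    intro x hx hx'
    obtain ⟨k, -, rfl⟩ := Finset.mem_image.mp hx
    rw [hI] at hx; rw [hJ] at hx'
    rw [hx] at hx'; norm_num at hx'
  set S := M.submatrix (fun i : {x : Fin n // x ∈ I} => (i : Fin n))
          (fun j : {x : Fin n // x ∈ J} => (j : Fin n)) with hS
  let R : Matrix κ {x : Fin n // x ∈ I} ℝ := Matrix.of fun i x => if (x : Fin n) = a i then 2 else 0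
  let C : Matrix {x : Fin n // x ∈ J} κ ℝ := Matrix.of fun x i => if (x : Fin n) = a i then 1 else 0
  let P : Matrix κ κ ℝ := R * S * C
  have hP : ∀ i j, P i j = if d i = 1 ∧ d j = -1 then 2 * A i j else 0 := by
    intro i j
    have hRS : ∀ y, (R * S) i y = if d i = 1 then 2 * M (a i) y else 0 := by
      intro y
      simp only [mul_apply, R, S, of_apply, submatrix_apply, ite_mul, zero_mul]
      split_ifs with h
      · rw [Finset.sum_eq_single (⟨a i, (hI i).2 h⟩ : {x : Fin n // x ∈ I})]
        · simp
        · intro b _ hb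
          rw [if_neg]; intro h'; exact hb (Subtype.ext h')
        · simp
      · refine Finset.sum_eq_zero fun x _ => ?_
        rw [if_neg]; intro h'; exact h ((hI i).1 (h' ▸ x.2))
    simp only [P]
    rw [mul_apply]
    simp only [hRS, C, of_apply, mul_ite, mul_one, mul_zero]
    by_cases h : d j = -1
    · rw [Finset.sum_eq_single (⟨a j, (hJ j).2 h⟩ : {x : Fin n // x ∈ J})]
      · simp [h, A]
      · intro b _ hb
        rw [if_neg]; intro h'; exact hb (Subtype.ext h')
      · simp
    · rw [if_neg (fun h' => h h'.2)]
      refine Finset.sum_eq_zero fun x _ => ?_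
      rw [if_neg]; intro h'; exact h ((hJ j).1 (h' ▸ x.2))
  have hNP : N = P + (-1 : Matrix κ κ ℝ) * Pᵀ := by
    ext i j
    rw [neg_one_mul, Matrix.add_apply, Matrix.neg_apply, transpose_apply, hP, hP, hA j i]
    simp only [hNdef, of_apply]
    rcases hd i (Finset.mem_univ _) with h | h <;> rcases hd j (Finset.mem_univ _) with h' | h' <;>
      rw [h, h'] <;> norm_num <;> ring
  have hPr : P.rank ≤ S.rank :=
    (rank_mul_le_left _ _).trans (rank_mul_le_right _ _)
  have h1 : N.rank ≤ P.rank + P.rank := by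
    rw [hNP]
    refine (my_rank_add _ _).trans (Nat.add_le_add_left ?_ _)
    exact (rank_mul_le_right _ _).trans (rank_transpose P).le
  have h2 : M.rank ≤ 2 * S.rank := by omega
  have h3 : (M.rank : ℝ) ≤ 2 * S.rank := by exact_mod_cast h2
  linarith
end
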